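/- arXiv:2302.09712 — 5 statements merged into one kernel-verified Lean document; each statement's English description precedes it below -/
import Mathlib

section
/- For every θ ∈ [0,π], J_{1,0}(θ) = (1 + cos θ)/(2√(2π)). -/
open MeasureTheory ProbabilityTheory

/-- The standard Gaussian measure on ℝ. -/
noncomputable def stdGaussian : Measure ℝ := gaussianReal 0 1

/-- `Ĝ = G cos θ + W sin θ` built from a pair `p = (G, W)` of independent standard normals. -/
noncomputable def ghat (θ : ℝ) (p : ℝ × ℝ) : ℝ := p.1 * Real.cos θ + p.2 * Real.sin θ

/-- The mixed moment `J_{a,b}(θ) = E[G^a Ĝ^b · 1{G>0} · 1{Ĝ>0}]`, where `G, W` are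
independent standard normals and `Ĝ = G cos θ + W sin θ`. -/
noncomputable def J (a b : ℕ) (θ : ℝ) : ℝ :=
  ∫ p : ℝ × ℝ,
    p.1 ^ a * ghat θ p ^ b * (if 0 < p.1 then (1 : ℝ) else 0) *
      (if 0 < ghat θ p then (1 : ℝ) else 0)
    ∂(stdGaussian.prod stdGaussian)

lemma inv_sqrt_two_pi_mul_self :
    (√(2 * Real.pi))⁻¹ * (√(2 * Real.pi))⁻¹ = (2 * Real.pi)⁻¹ := by
  rw [← mul_inv, Real.mul_self_sqrt (by positivity)]

/-- The integral of a function of two independent standard normals, in polar coordinates. -/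
lemma integral_prod_stdGaussian (f : ℝ × ℝ → ℝ) :
    ∫ p, f p ∂(_root_.stdGaussian.prod _root_.stdGaussian) =
      ∫ q in Set.Ioi (0 : ℝ) ×ˢ Set.Ioo (-Real.pi) Real.pi,
        q.1 * ((2 * Real.pi)⁻¹ * Real.exp (-(1 / 2) * q.1 ^ 2) *
          f (q.1 * Real.cos q.2, q.1 * Real.sin q.2)) := by
  have hprod : _root_.stdGaussian.prod _root_.stdGaussian =
      (volume : Measure (ℝ × ℝ)).withDensity
        (fun p => gaussianPDF 0 1 p.1 * gaussianPDF 0 1 p.2) := by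
    rw [_root_.stdGaussian, gaussianReal_of_var_ne_zero _ one_ne_zero,
      prod_withDensity (measurable_gaussianPDF 0 1) (measurable_gaussianPDF 0 1),
      Measure.volume_eq_prod]
  rw [hprod, integral_withDensity_eq_integral_toReal_smul (by fun_prop)
    (Filter.Eventually.of_forall fun p => ENNReal.mul_lt_top gaussianPDF_lt_top gaussianPDF_lt_top),
    ← integral_comp_polarCoord_symm]
  simp only [polarCoord_target, polarCoord_symm_apply, smul_eq_mul, ENNReal.toReal_mul,
    toReal_gaussianPDF]
  congr 1 with q
  have hexp : Real.exp (-(q.1 * Real.cos q.2) ^ 2 / 2) *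
      Real.exp (-(q.1 * Real.sin q.2) ^ 2 / 2) = Real.exp (-(1 / 2) * q.1 ^ 2) := by
    rw [← Real.exp_add]
    congr 1
    linear_combination (-(q.1 ^ 2) / 2) * Real.sin_sq_add_cos_sq q.2
  simp only [gaussianPDFReal, NNReal.coe_one, mul_one, sub_zero]
  rw [← inv_sqrt_two_pi_mul_self, ← hexp]
  ring

lemma integral_sq_mul_exp_neg_half_sq :
    ∫ r in Set.Ioi (0 : ℝ), r ^ 2 * Real.exp (-(1 / 2) * r ^ 2) = √(2 * Real.pi) / 2 := by
  have h := integral_rpow_mul_exp_neg_mul_rpow (p := 2) (q := 2) (b := 1 / 2)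
    (by norm_num) (by norm_num) (by norm_num)
  have hΓ : Real.Gamma ((2 + 1) / 2) = √Real.pi / 2 := by
    rw [show ((2 : ℝ) + 1) / 2 = 1 / 2 + 1 by norm_num, Real.Gamma_add_one (by norm_num),
      Real.Gamma_one_half_eq]
    ring
  have hpow : (1 / 2 : ℝ) ^ (-((2 : ℝ) + 1) / 2) = 2 * √2 := by
    rw [one_div, Real.inv_rpow (by norm_num), ← Real.rpow_neg (by norm_num),
      show -(-((2 : ℝ) + 1) / 2) = 1 + 1 / 2 by norm_num, Real.rpow_add (by norm_num),
      Real.rpow_one, ← Real.sqrt_eq_rpow]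
  rw [hΓ, hpow] at h
  simp only [Real.rpow_two] at h
  rw [h, Real.sqrt_mul (by norm_num)]
  ring

/-- On `(-π, π)` the half-planes `cos ψ > 0` and `cos (ψ - θ) > 0` meet in `(θ - π/2, π/2)`. -/
lemma cos_pos_and_cos_sub_pos_iff {θ ψ : ℝ} (hθ : θ ∈ Set.Icc 0 Real.pi)
    (hψ : ψ ∈ Set.Ioo (-Real.pi) Real.pi) :
    (0 < Real.cos ψ ∧ 0 < Real.cos (ψ - θ)) ↔
      ψ ∈ Set.Ioo (θ - Real.pi / 2) (Real.pi / 2) := by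
  obtain ⟨hθ0, hθπ⟩ := hθ
  obtain ⟨hψ1, hψ2⟩ := hψ
  constructor
  · rintro ⟨h1, h2⟩
    have hlt : ψ < Real.pi / 2 := by
      by_contra! h
      linarith [Real.cos_nonpos_of_pi_div_two_le_of_le h (by linarith)]
    have hgt : -(Real.pi / 2) < ψ := by
      by_contra! h
      have := Real.cos_nonpos_of_pi_div_two_le_of_le (x := -ψ) (by linarith) (by linarith)
      rw [Real.cos_neg] at this
      linarith
    refine ⟨?_, hlt⟩
    by_contra! h
    have := Real.cos_nonpos_of_pi_div_two_le_of_le (x := -(ψ - θ)) (by linarith) (by linarith)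
    rw [Real.cos_neg] at this
    linarith
  · rintro ⟨h1, h2⟩
    exact ⟨Real.cos_pos_of_mem_Ioo ⟨by linarith, h2⟩,
      Real.cos_pos_of_mem_Ioo ⟨by linarith, by linarith⟩⟩

lemma integral_indicator_cos {θ : ℝ} (hθ : θ ∈ Set.Icc 0 Real.pi) :
    ∫ ψ in Set.Ioo (-Real.pi) Real.pi,
      (Set.Ioo (θ - Real.pi / 2) (Real.pi / 2)).indicator Real.cos ψ = 1 + Real.cos θ := by
  obtain ⟨hθ0, hθπ⟩ := hθ
  have hpi := Real.pi_pos
  rw [setIntegral_indicator measurableSet_Ioo, Set.inter_eq_self_of_subset_right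
    (Set.Ioo_subset_Ioo (by linarith) (by linarith)), ← integral_Ioc_eq_integral_Ioo,
    ← intervalIntegral.integral_of_le (by linarith), integral_cos, Real.sin_pi_div_two,
    Real.sin_sub_pi_div_two, sub_neg_eq_add]

/-- `J_{1,0}(θ) = (1 + cos θ)/(2√(2π))` for all `θ ∈ [0, π]`. -/
theorem J_one_zero (θ : ℝ) (hθ : θ ∈ Set.Icc 0 Real.pi) :
    J 1 0 θ = (1 + Real.cos θ) / (2 * Real.sqrt (2 * Real.pi)) := by
  have hpolar : ∀ q ∈ Set.Ioi (0 : ℝ) ×ˢ Set.Ioo (-Real.pi) Real.pi,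
      q.1 * ((2 * Real.pi)⁻¹ * Real.exp (-(1 / 2) * q.1 ^ 2) *
        ((q.1 * Real.cos q.2) ^ 1 * ghat θ (q.1 * Real.cos q.2, q.1 * Real.sin q.2) ^ 0 *
          (if 0 < q.1 * Real.cos q.2 then (1 : ℝ) else 0) *
          (if 0 < ghat θ (q.1 * Real.cos q.2, q.1 * Real.sin q.2) then (1 : ℝ) else 0))) =
      (2 * Real.pi)⁻¹ * ((q.1 ^ 2 * Real.exp (-(1 / 2) * q.1 ^ 2)) *
        (Set.Ioo (θ - Real.pi / 2) (Real.pi / 2)).indicator Real.cos q.2) := by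
    rintro ⟨r, ψ⟩ ⟨hr, hψ⟩
    have hr : 0 < r := hr
    have hghat : ghat θ (r * Real.cos ψ, r * Real.sin ψ) = r * Real.cos (ψ - θ) := by
      rw [ghat, Real.cos_sub]
      ring
    simp only [hghat, mul_pos_iff_of_pos_left hr, Set.indicator_apply,
      ← cos_pos_and_cos_sub_pos_iff hθ hψ, pow_zero, pow_one, mul_one]
    split_ifs <;> first | tauto | ring
  rw [J, integral_prod_stdGaussian,
    setIntegral_congr_fun (measurableSet_Ioi.prod measurableSet_Ioo) hpolar,
    integral_const_mul, Measure.volume_eq_prod, setIntegral_prod_mul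
      (fun r : ℝ => r ^ 2 * Real.exp (-(1 / 2) * r ^ 2)),
    integral_sq_mul_exp_neg_half_sq, integral_indicator_cos hθ]
  have hpos : 0 < √(2 * Real.pi) := by positivity
  rw [← inv_sqrt_two_pi_mul_self]
  field_simp
end

section
/- For every integer a ≥ 2 and every θ ∈ [0,π], J_{a,0}(θ) = (a−1)·J_{a−2,0}(θ) + (sin^{a−1} θ · cos θ / c_{a mod 2}) · (a−2)!!, where c_0 = 2π and c_1 = 2√(2π), and m!! denotes the double factorial. -/
open MeasureTheory ProbabilityTheory

/-- The normalizing constants `c_0 = 2π`, `c_1 = 2√(2π)`. -/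
noncomputable def cConst : ℕ → ℝ := fun i => if i = 0 then 2 * Real.pi else 2 * Real.sqrt (2 * Real.pi)

/-- The probability that `g cos θ + W sin θ` is positive, for a standard normal `W`. -/
noncomputable def ghatPosProb (θ g : ℝ) : ℝ :=
  ∫ w, (if 0 < ghat θ (g, w) then (1 : ℝ) else 0) ∂stdGaussian

instance : IsProbabilityMeasure _root_.stdGaussian := by
  unfold _root_.stdGaussian; infer_instance

lemma integrable_pow_gaussianReal (n : ℕ) : Integrable (fun x : ℝ => x ^ n) (gaussianReal 0 1) := by
  rcases eq_or_ne n 0 with rfl | hn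
  · simp
  · have h := (memLp_id_gaussianReal (μ := 0) (v := 1) n).integrable_norm_pow hn
    refine h.mono' (by fun_prop) ?_
    filter_upwards with x
    simp

lemma integrable_pow_mul_gaussianPDFReal (n : ℕ) :
    Integrable (fun x : ℝ => x ^ n * gaussianPDFReal 0 1 x) := by
  have h := integrable_pow_gaussianReal n
  rw [gaussianReal_of_var_ne_zero 0 one_ne_zero,
    integrable_withDensity_iff_integrable_smul' (measurable_gaussianPDF 0 1)
      (by filter_upwards with x using gaussianPDF_lt_top)] at h
  simpa [toReal_gaussianPDF, mul_comm] using h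

lemma hasDerivAt_gaussianPDFReal_zero_one (x : ℝ) :
    HasDerivAt (gaussianPDFReal 0 1) (-x * gaussianPDFReal 0 1 x) x := by
  have h : HasDerivAt (fun y : ℝ => -(y - 0) ^ 2 / (2 * ((1 : NNReal) : ℝ))) (-x) x := by
    refine ((((hasDerivAt_id x).sub_const 0).pow 2).neg.div_const
      (2 * ((1 : NNReal) : ℝ))).congr_deriv ?_
    simp
    ring
  refine (h.exp.const_mul (√(2 * Real.pi * ((1 : NNReal) : ℝ)))⁻¹).congr_deriv ?_
  rw [gaussianPDFReal]
  ring

lemma continuous_gaussianPDFReal_zero_one : Continuous (gaussianPDFReal 0 1) :=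
  continuous_iff_continuousAt.2 fun x => (hasDerivAt_gaussianPDFReal_zero_one x).continuousAt

lemma integrable_pow_mul_bdd_mul_gaussianPDFReal (n : ℕ) {H : ℝ → ℝ} (hH : Continuous H) {C : ℝ}
    (hC : ∀ x, |H x| ≤ C) : Integrable (fun x : ℝ => x ^ n * H x * gaussianPDFReal 0 1 x) := by
  have h := (integrable_pow_mul_gaussianPDFReal n).bdd_mul (c := C) hH.aestronglyMeasurable
    (by filter_upwards with x using hC x)
  refine h.congr ?_
  filter_upwards with x
  ring

/-- Gaussian integration by parts on the positive half-line. -/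
lemma integral_Ioi_pow_add_two_mul_gaussianPDFReal (n : ℕ) {H H' : ℝ → ℝ}
    (hd : ∀ x, HasDerivAt H (H' x) x) (hH' : Continuous H') {C C' : ℝ}
    (hC : ∀ x, |H x| ≤ C) (hC' : ∀ x, |H' x| ≤ C') :
    ∫ x in Set.Ioi 0, x ^ (n + 2) * H x * gaussianPDFReal 0 1 x =
      (n + 1) * (∫ x in Set.Ioi 0, x ^ n * H x * gaussianPDFReal 0 1 x) +
        ∫ x in Set.Ioi 0, x ^ (n + 1) * H' x * gaussianPDFReal 0 1 x := by
  have hH : Continuous H := continuous_iff_continuousAt.2 fun x => (hd x).continuousAt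
  have i0 := (integrable_pow_mul_bdd_mul_gaussianPDFReal n hH hC).integrableOn (s := Set.Ioi 0)
  have i1 := (integrable_pow_mul_bdd_mul_gaussianPDFReal (n + 1) hH hC).integrableOn
    (s := Set.Ioi 0)
  have i2 := (integrable_pow_mul_bdd_mul_gaussianPDFReal (n + 2) hH hC).integrableOn
    (s := Set.Ioi 0)
  have i3 := (integrable_pow_mul_bdd_mul_gaussianPDFReal (n + 1) hH' hC').integrableOn
    (s := Set.Ioi 0)
  have hderiv (x : ℝ) : HasDerivAt (fun x => x ^ (n + 1) * H x * gaussianPDFReal 0 1 x)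
      ((n + 1) * (x ^ n * H x * gaussianPDFReal 0 1 x) +
        x ^ (n + 1) * H' x * gaussianPDFReal 0 1 x -
        x ^ (n + 2) * H x * gaussianPDFReal 0 1 x) x := by
    refine (((hasDerivAt_pow (n + 1) x).mul (hd x)).mul
      (hasDerivAt_gaussianPDFReal_zero_one x)).congr_deriv ?_
    simp only [Pi.mul_apply, Nat.cast_add, Nat.cast_one, Nat.add_sub_cancel]
    ring
  have h_int := ((i0.const_mul ((n : ℝ) + 1)).add i3).sub i2
  have ht := tendsto_zero_of_hasDerivAt_of_integrableOn_Ioi (fun x _ => hderiv x) h_int i1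
  have key := integral_Ioi_of_hasDerivAt_of_tendsto' (fun x _ => hderiv x) h_int ht
  have hsub := integral_sub ((i0.const_mul ((n : ℝ) + 1)).add i3) i2
  have hadd := integral_add (i0.const_mul ((n : ℝ) + 1)) i3
  rw [integral_const_mul] at hadd
  simp only [Pi.add_apply] at hsub
  rw [hsub, hadd] at key
  simp only [ne_eq, Nat.add_eq_zero_iff, one_ne_zero, and_false, not_false_eq_true, zero_pow,
    zero_mul, sub_zero] at key
  linarith

lemma J_zero_right_eq_integral_Ioi (n : ℕ) (θ : ℝ) :
    J n 0 θ = ∫ x in Set.Ioi 0, x ^ n * ghatPosProb θ x * gaussianPDFReal 0 1 x := by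
  have hpow : Integrable (fun p : ℝ × ℝ => p.1 ^ n) (stdGaussian.prod stdGaussian) := by
    have h : Integrable (fun x : ℝ => x ^ n) stdGaussian := integrable_pow_gaussianReal n
    simpa using h.mul_prod (integrable_const (1 : ℝ) (μ := stdGaussian))
  have hg : Measurable (ghat θ) := by unfold ghat; fun_prop
  have h_int : Integrable (fun p : ℝ × ℝ =>
      p.1 ^ n * ghat θ p ^ 0 * (if 0 < p.1 then (1 : ℝ) else 0) *
        (if 0 < ghat θ p then (1 : ℝ) else 0)) (stdGaussian.prod stdGaussian) := by
    refine hpow.mono ?_ ?_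
    · refine Measurable.aestronglyMeasurable ?_
      refine Measurable.mul (Measurable.mul (by fun_prop) ?_) ?_
      · exact Measurable.ite (measurableSet_lt measurable_const measurable_fst)
          measurable_const measurable_const
      · exact Measurable.ite (measurableSet_lt measurable_const hg)
          measurable_const measurable_const
    · filter_upwards with p
      split_ifs <;> simp
  rw [J, integral_prod _ h_int]
  simp only [pow_zero, mul_one]
  rw [_root_.stdGaussian, integral_gaussianReal_eq_integral_smul one_ne_zero,
    ← integral_indicator measurableSet_Ioi]
  congr 1
  ext x
  by_cases hx : 0 < x
  · simp only [hx, if_true, mul_one, integral_const_mul]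
    simp [hx, ghatPosProb, _root_.stdGaussian]
    ring
  · simp [hx]

lemma abs_ghatPosProb_le_one (θ g : ℝ) : |ghatPosProb θ g| ≤ 1 := by
  have h := norm_integral_le_of_norm_le_const (C := 1) (μ := stdGaussian)
    (f := fun w => if 0 < ghat θ (g, w) then (1 : ℝ) else 0)
    (by filter_upwards with w; split_ifs <;> simp)
  simpa [ghatPosProb] using h

lemma ghatPosProb_eq_integral_Ioi {θ : ℝ} (hs : 0 < Real.sin θ) (g : ℝ) :
    ghatPosProb θ g =
      ∫ w in Set.Ioi (-(Real.cos θ / Real.sin θ * g)), gaussianPDFReal 0 1 w := by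
  rw [ghatPosProb, _root_.stdGaussian, integral_gaussianReal_eq_integral_smul one_ne_zero,
    ← integral_indicator measurableSet_Ioi]
  congr 1
  ext w
  have : 0 < ghat θ (g, w) ↔ -(Real.cos θ / Real.sin θ * g) < w := by
    have h : ghat θ (g, w) = (w - -(Real.cos θ / Real.sin θ * g)) * Real.sin θ := by
      simp only [ghat]
      field_simp
      ring
    rw [h, mul_pos_iff_of_pos_right hs, sub_pos]
  by_cases h : -(Real.cos θ / Real.sin θ * g) < w <;> simp [this, h]

lemma hasDerivAt_ghatPosProb {θ : ℝ} (hs : 0 < Real.sin θ) (g : ℝ) :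
    HasDerivAt (ghatPosProb θ) (Real.cos θ / Real.sin θ *
      gaussianPDFReal 0 1 (Real.cos θ / Real.sin θ * g)) g := by
  set c := Real.cos θ / Real.sin θ
  have heq : ghatPosProb θ = fun g => (∫ w in Set.Ioi 0, gaussianPDFReal 0 1 w) -
      ∫ w in (0 : ℝ)..(-(c * g)), gaussianPDFReal 0 1 w := by
    ext g
    rw [ghatPosProb_eq_integral_Ioi hs, ← intervalIntegral.integral_Ioi_sub_Ioi'
      (integrable_gaussianPDFReal 0 1).integrableOn (integrable_gaussianPDFReal 0 1).integrableOn]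
    ring
  rw [heq]
  have hF := (continuous_gaussianPDFReal_zero_one.integral_hasStrictDerivAt 0
    (-(c * g))).hasDerivAt
  have hin : HasDerivAt (fun g => -(c * g)) (-c) g := by
    exact ((hasDerivAt_id g).const_mul c).neg.congr_deriv (by simp)
  refine ((hF.comp g hin).const_sub (∫ w in Set.Ioi 0, gaussianPDFReal 0 1 w)).congr_deriv ?_
  simp [gaussianPDFReal, mul_comm]

lemma gaussianPDFReal_zero_one_le_one (x : ℝ) : |gaussianPDFReal 0 1 x| ≤ 1 := by
  rw [abs_of_nonneg (gaussianPDFReal_nonneg 0 1 x), gaussianPDFReal]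
  have h1 : (√(2 * Real.pi * ((1 : NNReal) : ℝ)))⁻¹ ≤ 1 := by
    refine inv_le_one_of_one_le₀ (Real.one_le_sqrt.2 ?_)
    have := Real.pi_gt_three
    simp
    linarith
  refine mul_le_one₀ h1 (Real.exp_pos _).le (Real.exp_le_one_iff.2 ?_)
  simp only [sub_zero, NNReal.coe_one]
  nlinarith [sq_nonneg x]

lemma integral_Ioi_pow_succ_mul_exp_neg_sq (n : ℕ) {s : ℝ} (hs : 0 < s) :
    ∫ x in Set.Ioi (0 : ℝ), x ^ (n + 1) * Real.exp (-(1 / (2 * s ^ 2)) * x ^ 2) =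
      2 * Real.pi / cConst (n % 2) * s ^ (n + 2) * (Nat.doubleFactorial n : ℝ) := by
  have h := integral_rpow_mul_exp_neg_mul_rpow (p := 2) (q := n + 1) (b := 1 / (2 * s ^ 2))
    two_pos (by linarith [n.cast_nonneg (α := ℝ)]) (by positivity)
  have h' : ∫ x in Set.Ioi (0 : ℝ), x ^ (n + 1) * Real.exp (-(1 / (2 * s ^ 2)) * x ^ 2) =
      ∫ x in Set.Ioi (0 : ℝ), x ^ ((n : ℝ) + 1) *
        Real.exp (-(1 / (2 * s ^ 2)) * x ^ (2 : ℝ)) := by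
    congr 1
    ext x
    rw [← Nat.cast_add_one, Real.rpow_natCast, Real.rpow_two]
  rw [h', h, one_div, Real.inv_rpow (by positivity), neg_div, Real.rpow_neg (by positivity),
    inv_inv]
  have hpi := Real.pi_pos
  rcases Nat.even_or_odd' n with ⟨k, rfl | rfl⟩
  · have e : (((2 * k : ℕ) : ℝ) + 1 + 1) / 2 = ((k + 1 : ℕ) : ℝ) := by push_cast; ring
    have e' : (((2 * k : ℕ) : ℝ) + 1 + 1) / 2 = (k : ℝ) + 1 := by push_cast; ring
    rw [e', Real.Gamma_nat_eq_factorial, ← e', e, Real.rpow_natCast, Nat.doubleFactorial_two_mul]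
    simp only [cConst, Nat.mul_mod_right, if_true]
    push_cast
    field_simp
    ring
  · have e : (((2 * k + 1 : ℕ) : ℝ) + 1 + 1) / 2 = ((k + 1 : ℕ) : ℝ) + 1 / 2 := by
      push_cast; ring
    have hr : (2 * s ^ 2) ^ (((k + 1 : ℕ) : ℝ) + 1 / 2) = (2 * s ^ 2) ^ (k + 1) * (√2 * s) := by
      rw [Real.rpow_add (by positivity), Real.rpow_natCast, ← Real.sqrt_eq_rpow,
        Real.sqrt_mul zero_le_two, Real.sqrt_sq hs.le]
    rw [e, hr, Real.Gamma_nat_add_half, show 2 * (k + 1) - 1 = 2 * k + 1 by lia]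
    have hm : (2 * k + 1) % 2 = 1 := by lia
    simp only [cConst, hm, one_ne_zero, if_false]
    rw [Real.sqrt_mul zero_le_two]
    have h2 : √2 ^ 2 = 2 := Real.sq_sqrt zero_le_two
    have hp2 : √Real.pi ^ 2 = Real.pi := Real.sq_sqrt hpi.le
    have hp0 : 0 < √Real.pi := Real.sqrt_pos.2 hpi
    field_simp
    rw [h2, hp2]
    ring

lemma gaussianPDFReal_mul_gaussianPDFReal_cot {θ : ℝ} (hs : 0 < Real.sin θ) (x : ℝ) :
    gaussianPDFReal 0 1 (Real.cos θ / Real.sin θ * x) * gaussianPDFReal 0 1 x =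
      1 / (2 * Real.pi) * Real.exp (-(1 / (2 * Real.sin θ ^ 2)) * x ^ 2) := by
  have hpi := Real.pi_pos
  simp only [gaussianPDFReal, sub_zero, NNReal.coe_one, mul_one]
  rw [mul_mul_mul_comm, ← Real.exp_add, ← mul_inv, Real.mul_self_sqrt (by positivity), one_div]
  congr 2
  field_simp
  rw [Real.cos_sq']
  ring

lemma integral_Ioi_pow_mul_deriv_ghatPosProb (n : ℕ) {θ : ℝ} (hs : 0 < Real.sin θ) :
    ∫ x in Set.Ioi 0, x ^ (n + 1) * (Real.cos θ / Real.sin θ *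
      gaussianPDFReal 0 1 (Real.cos θ / Real.sin θ * x)) * gaussianPDFReal 0 1 x =
      Real.sin θ ^ (n + 1) * Real.cos θ / cConst (n % 2) * (Nat.doubleFactorial n : ℝ) := by
  have h (x : ℝ) : x ^ (n + 1) * (Real.cos θ / Real.sin θ *
      gaussianPDFReal 0 1 (Real.cos θ / Real.sin θ * x)) * gaussianPDFReal 0 1 x =
      Real.cos θ / Real.sin θ / (2 * Real.pi) *
        (x ^ (n + 1) * Real.exp (-(1 / (2 * Real.sin θ ^ 2)) * x ^ 2)) := by
    linear_combination x ^ (n + 1) * (Real.cos θ / Real.sin θ) *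
      gaussianPDFReal_mul_gaussianPDFReal_cot hs x
  simp only [h]
  rw [integral_const_mul, integral_Ioi_pow_succ_mul_exp_neg_sq n hs]
  have hpi := Real.pi_pos
  field_simp
  ring

lemma J_add_two_zero (n : ℕ) {θ : ℝ} (hθ : θ ∈ Set.Icc 0 Real.pi) :
    J (n + 2) 0 θ = (n + 1) * J n 0 θ +
      Real.sin θ ^ (n + 1) * Real.cos θ / cConst (n % 2) * (Nat.doubleFactorial n : ℝ) := by
  rw [J_zero_right_eq_integral_Ioi, J_zero_right_eq_integral_Ioi]
  rcases (Real.sin_nonneg_of_mem_Icc hθ).eq_or_lt with hs | hs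
  · obtain ⟨C, hC⟩ : ∃ C : ℝ, ∀ x ∈ Set.Ioi (0 : ℝ), ghatPosProb θ x = C := by
      refine ⟨if 0 < Real.cos θ then 1 else 0, fun x hx => ?_⟩
      simp [ghatPosProb, ghat, ← hs, mul_pos_iff_of_pos_left (Set.mem_Ioi.1 hx)]
    have hcongr (m : ℕ) : ∫ x in Set.Ioi 0, x ^ m * ghatPosProb θ x * gaussianPDFReal 0 1 x =
        ∫ x in Set.Ioi 0, x ^ m * C * gaussianPDFReal 0 1 x :=
      setIntegral_congr_fun measurableSet_Ioi fun x hx => by simp only [hC x hx]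
    rw [hcongr, hcongr, integral_Ioi_pow_add_two_mul_gaussianPDFReal n (H := fun _ => C)
      (H' := fun _ => 0) (fun x => hasDerivAt_const x C) continuous_const (fun _ => le_rfl)
      (fun _ => le_rfl)]
    simp [← hs]
  · rw [integral_Ioi_pow_add_two_mul_gaussianPDFReal n (hasDerivAt_ghatPosProb hs)
      (continuous_const.mul (continuous_gaussianPDFReal_zero_one.comp (by fun_prop)))
      (abs_ghatPosProb_le_one θ) (C' := |Real.cos θ / Real.sin θ|),
      integral_Ioi_pow_mul_deriv_ghatPosProb n hs]
    intro x
    rw [abs_mul]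
    exact mul_le_of_le_one_right (abs_nonneg _) (gaussianPDFReal_zero_one_le_one _)

/-- For `a ≥ 2`,
`J_{a,0}(θ) = (a−1)·J_{a−2,0}(θ) + (sin^{a−1} θ · cos θ / c_{a mod 2}) · (a−2)!!`. -/
theorem J_a_zero_recurrence (a : ℕ) (ha : 2 ≤ a) (θ : ℝ) (hθ : θ ∈ Set.Icc 0 Real.pi) :
    J a 0 θ = (a - 1 : ℝ) * J (a - 2) 0 θ
      + Real.sin θ ^ (a - 1) * Real.cos θ / cConst (a % 2) * (Nat.doubleFactorial (a - 2) : ℝ) := by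
  obtain ⟨n, rfl⟩ := Nat.exists_eq_add_of_le' ha
  rw [J_add_two_zero n hθ, Nat.add_mod_right, Nat.add_sub_cancel, Nat.add_succ_sub_one]
  push_cast
  ring
end

section
/- With S := (2/n²) · Σ_{i=1}^{n} Σ_{j=1}^{n} (φ(G_i)φ(Ĝ_j) − φ(G_j)φ(Ĝ_i))², one has E[S] = (n−1)(1 − 4·J_{1,1}(θ)²)/n. -/
open MeasureTheory ProbabilityTheory

/-- The law of the i.i.d. pairs `(G_i, W_i)`. -/
noncomputable def pairLaw : Measure (ℝ × ℝ) := stdGaussian.prod stdGaussian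

/-- The joint law of `n` i.i.d. pairs of independent standard normals. -/
noncomputable def piMeasure (n : ℕ) : Measure (Fin n → ℝ × ℝ) :=
  MeasureTheory.Measure.pi fun _ : Fin n => pairLaw

/-- `R = (4/n²) Σ_{i,j} φ²(G_i) φ²(Ĝ_j)`. -/
noncomputable def Rfun (n : ℕ) (θ : ℝ) (ω : Fin n → ℝ × ℝ) : ℝ :=
  4 / (n : ℝ) ^ 2 * ∑ i : Fin n, ∑ j : Fin n, max (ω i).1 0 ^ 2 * max (ghat θ (ω j)) 0 ^ 2

/-- `S = (2/n²) Σ_{i,j} (φ(G_i)φ(Ĝ_j) − φ(G_j)φ(Ĝ_i))²`. -/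
noncomputable def Sfun (n : ℕ) (θ : ℝ) (ω : Fin n → ℝ × ℝ) : ℝ :=
  2 / (n : ℝ) ^ 2 * ∑ i : Fin n, ∑ j : Fin n,
    (max (ω i).1 0 * max (ghat θ (ω j)) 0 - max (ω j).1 0 * max (ghat θ (ω i)) 0) ^ 2

instance isProbabilityMeasure_stdGaussian : IsProbabilityMeasure _root_.stdGaussian := by
  unfold _root_.stdGaussian
  infer_instance

instance isProbabilityMeasure_pairLaw : IsProbabilityMeasure pairLaw := by
  unfold pairLaw
  infer_instance

lemma measurable_ghat (θ : ℝ) : Measurable (ghat θ) := by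
  unfold ghat
  fun_prop

lemma measurePreserving_ghat (θ : ℝ) :
    MeasurePreserving (ghat θ) pairLaw (gaussianReal 0 1) := by
  refine ⟨measurable_ghat θ, ?_⟩
  have hind : IndepFun (fun p : ℝ × ℝ ↦ p.1 * Real.cos θ) (fun p ↦ p.2 * Real.sin θ) pairLaw :=
    indepFun_prod (X := (· * Real.cos θ)) (Y := (· * Real.sin θ)) (by fun_prop) (by fun_prop)
  have hfst : pairLaw.map (fun p : ℝ × ℝ ↦ p.1 * Real.cos θ) =
      gaussianReal (Real.cos θ * 0) (.mk (Real.cos θ ^ 2) (sq_nonneg _) * 1) := by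
    rw [← gaussianReal_map_mul_const, ← _root_.stdGaussian,
      ← (measurePreserving_fst (μ := _root_.stdGaussian) (ν := _root_.stdGaussian)).map_eq,
      Measure.map_map (by fun_prop) (by fun_prop)]
    rfl
  have hsnd : pairLaw.map (fun p : ℝ × ℝ ↦ p.2 * Real.sin θ) =
      gaussianReal (Real.sin θ * 0) (.mk (Real.sin θ ^ 2) (sq_nonneg _) * 1) := by
    rw [← gaussianReal_map_mul_const, ← _root_.stdGaussian,
      ← (measurePreserving_snd (μ := _root_.stdGaussian) (ν := _root_.stdGaussian)).map_eq,
      Measure.map_map (by fun_prop) (by fun_prop)]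
    rfl
  refine (gaussianReal_add_gaussianReal_of_indepFun hind hfst hsnd).trans ?_
  congr 1
  · simp
  · ext
    simp

lemma memLp_relu_gaussianReal : MemLp (fun x : ℝ ↦ max x 0) 2 (gaussianReal 0 1) := by
  refine (memLp_id_gaussianReal' 2 (by simp)).mono (by fun_prop) (.of_forall fun x ↦ ?_)
  simp only [Real.norm_eq_abs, id]
  rw [abs_of_nonneg (le_max_right _ _)]
  exact max_le (le_abs_self _) (abs_nonneg _)

lemma integral_relu_sq_gaussianReal : ∫ x : ℝ, max x 0 ^ 2 ∂gaussianReal 0 1 = 1 / 2 := by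
  have hint := memLp_relu_gaussianReal.integrable_sq
  have hmap : (gaussianReal 0 1).map (fun x : ℝ ↦ -x) = gaussianReal 0 1 := by
    rw [gaussianReal_map_neg, neg_zero]
  have hneg : MeasurePreserving (fun x : ℝ ↦ -x) (gaussianReal 0 1) (gaussianReal 0 1) :=
    ⟨measurable_neg, hmap⟩
  have hint' : Integrable (fun x : ℝ ↦ max (-x) 0 ^ 2) (gaussianReal 0 1) :=
    hneg.integrable_comp_of_integrable hint
  have hsymm : ∫ x : ℝ, max (-x) 0 ^ 2 ∂gaussianReal 0 1 = ∫ x : ℝ, max x 0 ^ 2 ∂gaussianReal 0 1 :=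
    hneg.integral_comp (MeasurableEquiv.neg ℝ).measurableEmbedding (fun x : ℝ ↦ max x 0 ^ 2)
  have hsq : ∫ x : ℝ, x ^ 2 ∂gaussianReal 0 1 = 1 := by
    have h := variance_of_integral_eq_zero (μ := gaussianReal 0 1) (X := fun x : ℝ ↦ x)
      (by fun_prop) integral_id_gaussianReal
    rw [← h, variance_fun_id_gaussianReal]
    simp
  have hadd : ∫ x : ℝ, x ^ 2 ∂gaussianReal 0 1 =
      ∫ x : ℝ, (max x 0 ^ 2 + max (-x) 0 ^ 2) ∂gaussianReal 0 1 := by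
    congr 1
    ext x
    rcases le_total 0 x with h | h
    · simp [h]
    · simp [h]
  rw [integral_add hint hint', hsymm, hsq] at hadd
  linarith

lemma integral_relu_mul_relu_ghat (θ : ℝ) :
    ∫ p, max p.1 0 * max (ghat θ p) 0 ∂pairLaw = J 1 1 θ := by
  unfold J pairLaw
  congr 1
  ext p
  split_ifs with h₁ h₂ h₂
  · simp [h₁.le, h₂.le]
  · simp [not_lt.mp h₂]
  · simp [not_lt.mp h₁]
  · simp [not_lt.mp h₁]

/-- The expected squared `2 × 2` minor formed by `f` and `g` at two independent sample points is
twice the Gram determinant of `f` and `g`. -/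
lemma integral_sq_minor_pi {ι α : Type*} [Fintype ι] [MeasurableSpace α] {μ : Measure α}
    [IsProbabilityMeasure μ] {f g : α → ℝ} (hf : MemLp f 2 μ) (hg : MemLp g 2 μ) {i j : ι}
    (hij : i ≠ j) :
    Integrable (fun ω : ι → α ↦ (f (ω i) * g (ω j) - f (ω j) * g (ω i)) ^ 2)
        (Measure.pi fun _ ↦ μ) ∧
      ∫ ω : ι → α, (f (ω i) * g (ω j) - f (ω j) * g (ω i)) ^ 2 ∂Measure.pi (fun _ ↦ μ) =
        2 * ((∫ x, f x ^ 2 ∂μ) * (∫ x, g x ^ 2 ∂μ) - (∫ x, f x * g x ∂μ) ^ 2) := by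
  have key : ∀ u v : α → ℝ, Integrable u μ → Integrable v μ →
      Integrable (fun ω : ι → α ↦ u (ω i) * v (ω j)) (Measure.pi fun _ ↦ μ) ∧
        ∫ ω : ι → α, u (ω i) * v (ω j) ∂Measure.pi (fun _ ↦ μ) =
          (∫ x, u x ∂μ) * ∫ x, v x ∂μ := by
    intro u v hu hv
    have hind : IndepFun (fun ω : ι → α ↦ u (ω i)) (fun ω ↦ v (ω j)) (Measure.pi fun _ ↦ μ) := by
      have hid : IndepFun (fun ω : ι → α ↦ ω i) (fun ω ↦ ω j) (Measure.pi fun _ ↦ μ) :=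
        (iIndepFun_pi (μ := fun _ : ι ↦ μ) (X := fun _ x ↦ x) fun _ ↦ aemeasurable_id).indepFun hij
      refine hid.comp₀ (φ := u) (ψ := v) (measurable_pi_apply i).aemeasurable
        (measurable_pi_apply j).aemeasurable ?_ ?_
      · rw [(measurePreserving_eval (fun _ : ι ↦ μ) i).map_eq]
        exact hu.aemeasurable
      · rw [(measurePreserving_eval (fun _ : ι ↦ μ) j).map_eq]
        exact hv.aemeasurable
    have hu' : Integrable (fun ω : ι → α ↦ u (ω i)) (Measure.pi fun _ ↦ μ) :=
      integrable_comp_eval (μ := fun _ : ι ↦ μ) hu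
    have hv' : Integrable (fun ω : ι → α ↦ v (ω j)) (Measure.pi fun _ ↦ μ) :=
      integrable_comp_eval (μ := fun _ : ι ↦ μ) hv
    refine ⟨hind.integrable_mul hu' hv', ?_⟩
    rw [hind.integral_fun_mul_eq_mul_integral hu'.1 hv'.1,
      integral_comp_eval (μ := fun _ : ι ↦ μ) hu.1, integral_comp_eval (μ := fun _ : ι ↦ μ) hv.1]
  have hfg : Integrable (fun x ↦ f x * g x) μ := hf.integrable_mul hg
  obtain ⟨i₁, e₁⟩ := key _ _ hf.integrable_sq hg.integrable_sq
  obtain ⟨i₂, e₂⟩ := key _ _ hg.integrable_sq hf.integrable_sq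
  obtain ⟨i₃, e₃⟩ := key _ _ hfg hfg
  have hexp : (fun ω : ι → α ↦ (f (ω i) * g (ω j) - f (ω j) * g (ω i)) ^ 2) = fun ω ↦
      f (ω i) ^ 2 * g (ω j) ^ 2 + g (ω i) ^ 2 * f (ω j) ^ 2 -
        2 * (f (ω i) * g (ω i) * (f (ω j) * g (ω j))) := by
    ext ω
    ring
  rw [hexp]
  have i₁₂ : Integrable (fun ω : ι → α ↦ f (ω i) ^ 2 * g (ω j) ^ 2 + g (ω i) ^ 2 * f (ω j) ^ 2)
      (Measure.pi fun _ ↦ μ) := i₁.add i₂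
  refine ⟨i₁₂.sub (i₃.const_mul 2), ?_⟩
  rw [integral_sub i₁₂ (i₃.const_mul 2), integral_add i₁ i₂, integral_const_mul, e₁, e₂, e₃]
  ring

/-- `E[S] = (n−1)(1 − 4·J_{1,1}(θ)²)/n`. -/
theorem expectation_S (n : ℕ) (hn : 1 ≤ n) (θ : ℝ) (hθ : θ ∈ Set.Icc 0 Real.pi) :
    ∫ ω, Sfun n θ ω ∂piMeasure n = ((n : ℝ) - 1) * (1 - 4 * J 1 1 θ ^ 2) / n := by
  have hghat := measurePreserving_ghat θ
  have hfst : MeasurePreserving Prod.fst pairLaw (gaussianReal 0 1) := measurePreserving_fst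
  have hf : MemLp (fun p : ℝ × ℝ ↦ max p.1 0) 2 pairLaw :=
    memLp_relu_gaussianReal.comp_measurePreserving hfst
  have hg : MemLp (fun p : ℝ × ℝ ↦ max (ghat θ p) 0) 2 pairLaw :=
    memLp_relu_gaussianReal.comp_measurePreserving hghat
  have hf2 : ∫ p : ℝ × ℝ, max p.1 0 ^ 2 ∂pairLaw = 1 / 2 := by
    rw [← integral_relu_sq_gaussianReal, ← hfst.map_eq,
      integral_map hfst.aemeasurable (by fun_prop)]
  have hg2 : ∫ p : ℝ × ℝ, max (ghat θ p) 0 ^ 2 ∂pairLaw = 1 / 2 := by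
    rw [← integral_relu_sq_gaussianReal, ← hghat.map_eq,
      integral_map hghat.aemeasurable (by fun_prop)]
  have hterm : ∀ i j : Fin n,
      Integrable (fun ω : Fin n → ℝ × ℝ ↦ (max (ω i).1 0 * max (ghat θ (ω j)) 0 -
        max (ω j).1 0 * max (ghat θ (ω i)) 0) ^ 2) (piMeasure n) ∧
      ∫ ω : Fin n → ℝ × ℝ, (max (ω i).1 0 * max (ghat θ (ω j)) 0 -
        max (ω j).1 0 * max (ghat θ (ω i)) 0) ^ 2 ∂piMeasure n =
        (1 / 2 - 2 * J 1 1 θ ^ 2) - if i = j then 1 / 2 - 2 * J 1 1 θ ^ 2 else 0 := by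
    intro i j
    by_cases hij : i = j
    · subst hij
      simp
    · obtain ⟨hint, heq⟩ := integral_sq_minor_pi hf hg hij
      refine ⟨hint, heq.trans ?_⟩
      rw [hf2, hg2, integral_relu_mul_relu_ghat, if_neg hij]
      ring
  have hn0 : (n : ℝ) ≠ 0 := by
    exact_mod_cast Nat.one_le_iff_ne_zero.mp hn
  unfold Sfun
  rw [integral_const_mul, integral_finsetSum _ fun i _ ↦ integrable_finsetSum _ fun j _ ↦
    (hterm i j).1]
  simp_rw [integral_finsetSum _ fun j _ ↦ (hterm _ j).1, (hterm _ _).2, Finset.sum_sub_distrib,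
    Finset.sum_ite_eq, Finset.mem_univ, if_true, Finset.sum_const, Finset.card_univ,
    Fintype.card_fin, nsmul_eq_mul]
  field_simp
  ring
end

section
/- With S := (2/n²) · Σ_{i=1}^{n} Σ_{j=1}^{n} (φ(G_i)φ(Ĝ_j) − φ(G_j)φ(Ĝ_i))², one has Var[S] = (8/n)(−8J_{1,1}⁴ + 8J_{1,1}²J_{2,2} + 4J_{1,1}² − 8J_{1,1}J_{3,1} + J_{2,2} + 1) + (2/n²)(80J_{1,1}⁴ − 96J_{1,1}²J_{2,2} − 40J_{1,1}² + 96J_{1,1}J_{3,1} + 24J_{2,2}² − 12J_{2,2} − 32J_{3,1}² + 5) + (2/n³)(−48J_{1,1}⁴ + 64J_{1,1}²J_{2,2} + 24J_{1,1}² − 64J_{1,1}J_{3,1} − 24J_{2,2}² + 8J_{2,2} + 32J_{3,1}² − 9), where J_{a,b} := J_{a,b}(θ). -/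
open MeasureTheory ProbabilityTheory

section UStatistic

variable {X : Type*} [MeasurableSpace X] {μ : Measure X} [IsProbabilityMeasure μ]

lemma measurePreserving_eval_pair {n : ℕ} {i j : Fin n} (hij : i ≠ j) :
    MeasurePreserving (fun ω : Fin n → X => (ω i, ω j)) (Measure.pi fun _ => μ) (μ.prod μ) := by
  have hind : iIndepFun (fun (k : Fin n) (ω : Fin n → X) => ω k) (Measure.pi fun _ => μ) :=
    iIndepFun_pi (X := fun _ : Fin n => (id : X → X)) fun _ => aemeasurable_id
  refine ⟨by fun_prop, ?_⟩
  have h := (hind.indepFun hij).map_prod_eq_prod_map_map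
    (measurable_pi_apply i).aemeasurable (measurable_pi_apply j).aemeasurable
  rwa [(measurePreserving_eval (fun _ : Fin n => μ) i).map_eq,
    (measurePreserving_eval (fun _ : Fin n => μ) j).map_eq] at h

lemma measurePreserving_eval_triple {n : ℕ} {i j k : Fin n} (hij : i ≠ j) (hik : i ≠ k)
    (hjk : j ≠ k) :
    MeasurePreserving (fun ω : Fin n → X => ((ω j, ω k), ω i)) (Measure.pi fun _ => μ)
      ((μ.prod μ).prod μ) := by
  have hind : iIndepFun (fun (k : Fin n) (ω : Fin n → X) => ω k) (Measure.pi fun _ => μ) :=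
    iIndepFun_pi (X := fun _ : Fin n => (id : X → X)) fun _ => aemeasurable_id
  refine ⟨by fun_prop, ?_⟩
  have h := (hind.indepFun_prodMk (by fun_prop) j k i hij.symm hik.symm).map_prod_eq_prod_map_map
    (by fun_prop) (measurable_pi_apply i).aemeasurable
  rwa [(measurePreserving_eval (fun _ : Fin n => μ) i).map_eq,
    (measurePreserving_eval_pair hjk).map_eq] at h

/-- Two evaluations of a kernel which share one argument have as covariance the variance of the
projection of the kernel. -/
lemma covariance_kernel_of_shared {h : X → X → ℝ}
    (hL2 : MemLp (fun p : X × X => h p.1 p.2) 2 (μ.prod μ)) {n : ℕ} {i j k : Fin n}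
    (hij : i ≠ j) (hik : i ≠ k) (hjk : j ≠ k)
    (hproj : MemLp (fun x => ∫ y, h x y ∂μ) 2 μ) :
    cov[fun ω : Fin n → X => h (ω i) (ω j), fun ω => h (ω i) (ω k); Measure.pi fun _ => μ] =
      Var[fun x => ∫ y, h x y ∂μ; μ] := by
  have hmean {a b : Fin n} (hab : a ≠ b) :
      ∫ ω : Fin n → X, h (ω a) (ω b) ∂(Measure.pi fun _ => μ) = ∫ x, ∫ y, h x y ∂μ ∂μ := by
    rw [← integral_prod (fun p : X × X => h p.1 p.2) (hL2.integrable (by norm_num)),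
      ← (measurePreserving_eval_pair hab).map_eq, integral_map (by fun_prop)]
    rw [(measurePreserving_eval_pair hab).map_eq]
    exact hL2.1
  have hM {a b : Fin n} (hab : a ≠ b) :
      MemLp (fun ω : Fin n → X => h (ω a) (ω b)) 2 (Measure.pi fun _ => μ) :=
    hL2.comp_measurePreserving (measurePreserving_eval_pair hab)
  have hT := measurePreserving_eval_triple (μ := μ) hij hik hjk
  have hprod : Integrable (fun q : (X × X) × X => h q.2 q.1.1 * h q.2 q.1.2)
      ((μ.prod μ).prod μ) := by
    have h1 : MeasurePreserving (fun q : (X × X) × X => (q.2, q.1.1)) ((μ.prod μ).prod μ)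
        (μ.prod μ) := Measure.measurePreserving_swap.comp
          ((measurePreserving_fst (μ := μ) (ν := μ)).prod (MeasurePreserving.id μ))
    have h2 : MeasurePreserving (fun q : (X × X) × X => (q.2, q.1.2)) ((μ.prod μ).prod μ)
        (μ.prod μ) := Measure.measurePreserving_swap.comp
          ((measurePreserving_snd (μ := μ) (ν := μ)).prod (MeasurePreserving.id μ))
    exact (hL2.comp_measurePreserving h1).integrable_mul (hL2.comp_measurePreserving h2)
  rw [covariance_eq_sub (hM hij) (hM hik), variance_eq_sub hproj, hmean hij, hmean hik, ← pow_two]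
  congr 1
  calc ∫ ω : Fin n → X, h (ω i) (ω j) * h (ω i) (ω k) ∂(Measure.pi fun _ => μ)
      = ∫ q, h q.2 q.1.1 * h q.2 q.1.2 ∂((μ.prod μ).prod μ) := by
        rw [← hT.map_eq, integral_map (by fun_prop)]
        rw [hT.map_eq]
        exact hprod.1
    _ = ∫ x, ∫ p : X × X, h x p.1 * h x p.2 ∂(μ.prod μ) ∂μ := integral_prod_symm _ hprod
    _ = _ := by simp_rw [integral_prod_mul]; simp [pow_two]

lemma sum_pair_overlap (n : ℕ) (V K : ℝ) :
    (∑ p : Fin n × Fin n, ∑ q : Fin n × Fin n, if p.1 = p.2 ∨ q.1 = q.2 then 0 else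
      K * ((if p.1 = q.1 then 1 else 0) + (if p.1 = q.2 then 1 else 0)
        + (if p.2 = q.1 then 1 else 0) + (if p.2 = q.2 then 1 else 0))
      + (V - 2 * K) * ((if p = q then 1 else 0) + (if p = q.swap then 1 else 0))) =
      2 * n * (n - 1) * V + 4 * n * (n - 1) * (n - 2) * K := by
  have inner (i j : Fin n) (hij : i ≠ j) : (∑ k : Fin n, ∑ l : Fin n, if k = l then 0 else
      K * ((if i = k then 1 else 0) + (if i = l then 1 else 0)
        + (if j = k then 1 else 0) + (if j = l then 1 else 0))
      + (V - 2 * K) * ((if i = k ∧ j = l then 1 else 0) + (if i = l ∧ j = k then 1 else 0))) =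
      2 * V + 4 * (n - 2) * K := by
    have h (k l : Fin n) : (if k = l then 0 else
      K * ((if i = k then 1 else 0) + (if i = l then 1 else 0)
        + (if j = k then 1 else 0) + (if j = l then 1 else 0))
      + (V - 2 * K) * ((if i = k ∧ j = l then 1 else 0) + (if i = l ∧ j = k then 1 else 0))) =
       K * ((if i = k then 1 else 0) + (if i = l then 1 else 0)
        + (if j = k then 1 else 0) + (if j = l then 1 else 0))
      + (V - 2 * K) * ((if i = k then if j = l then 1 else 0 else 0)
        + (if j = k then if i = l then 1 else 0 else 0))
      - (if k = l then 2 * K * ((if i = k then 1 else 0) + if j = k then 1 else 0) else 0) := by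
      split_ifs <;> grind
    simp only [h, Finset.sum_add_distrib, Finset.sum_sub_distrib, ← Finset.mul_sum,
      Finset.sum_ite_eq, Finset.mem_univ, if_true, Finset.sum_const, Finset.card_univ,
      Fintype.card_fin, nsmul_eq_mul, Finset.sum_ite_irrel]
    simp
    ring
  have outer (i j : Fin n) : (∑ k : Fin n, ∑ l : Fin n, if i = j ∨ k = l then 0 else
      K * ((if i = k then 1 else 0) + (if i = l then 1 else 0)
        + (if j = k then 1 else 0) + (if j = l then 1 else 0))
      + (V - 2 * K) * ((if i = k ∧ j = l then 1 else 0) + (if i = l ∧ j = k then 1 else 0))) =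
      (2 * V + 4 * (n - 2) * K) - if i = j then 2 * V + 4 * (n - 2) * K else 0 := by
    by_cases hij : i = j
    · simp [hij]
    · simp [hij, ← inner i j hij]
  simp_rw [Fintype.sum_prod_type, Prod.ext_iff, Prod.fst_swap, Prod.snd_swap, outer,
    Finset.sum_sub_distrib]
  simp
  ring

/-- The variance of `∑ i, ∑ j, h (ω i) (ω j)` for i.i.d. `ω i` and a symmetric kernel `h` vanishing
on the diagonal. -/
lemma variance_sum_kernel {h : X → X → ℝ} (hsymm : ∀ x y, h x y = h y x) (hdiag : ∀ x, h x x = 0)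
    (hL2 : MemLp (fun p : X × X => h p.1 p.2) 2 (μ.prod μ))
    (hproj : MemLp (fun x => ∫ y, h x y ∂μ) 2 μ) (n : ℕ) :
    Var[fun ω : Fin n → X => ∑ i, ∑ j, h (ω i) (ω j); Measure.pi fun _ => μ] =
      2 * n * (n - 1) * Var[fun p : X × X => h p.1 p.2; μ.prod μ]
        + 4 * n * (n - 1) * (n - 2) * Var[fun x => ∫ y, h x y ∂μ; μ] := by
  have hM (p : Fin n × Fin n) :
      MemLp (fun ω : Fin n → X => h (ω p.1) (ω p.2)) 2 (Measure.pi fun _ => μ) := by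
    by_cases hp : p.1 = p.2
    · simp [hp, hdiag]
    · exact hL2.comp_measurePreserving (measurePreserving_eval_pair hp)
  have hind : iIndepFun (fun (k : Fin n) (ω : Fin n → X) => ω k) (Measure.pi fun _ => μ) :=
    iIndepFun_pi (X := fun _ : Fin n => (id : X → X)) fun _ => aemeasurable_id
  simp_rw [← Fintype.sum_prod_type']
  rw [variance_fun_sum hM, ← sum_pair_overlap]
  refine Finset.sum_congr rfl fun p _ => Finset.sum_congr rfl fun q _ => ?_
  obtain ⟨i, j⟩ := p
  obtain ⟨k, l⟩ := q
  have hself {a b : Fin n} (hab : a ≠ b) :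
      cov[fun ω : Fin n → X => h (ω a) (ω b), fun ω => h (ω a) (ω b); Measure.pi fun _ => μ] =
        Var[fun p : X × X => h p.1 p.2; μ.prod μ] := by
    rw [covariance_self (hM (a, b)).aemeasurable]
    exact (measurePreserving_eval_pair hab).variance_fun_comp hL2.aemeasurable
  have hshare {a b c : Fin n} (hab : a ≠ b) (hac : a ≠ c) (hbc : b ≠ c) :=
    covariance_kernel_of_shared hL2 hab hac hbc hproj
  by_cases hij : i = j
  · simp [hij, hdiag]
  by_cases hkl : k = l
  · simp [hkl, hdiag]
  simp only [hij, hkl, or_self, if_false, Prod.mk.injEq, Prod.swap_prod_mk]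
  by_cases hik : i = k
  · subst hik
    by_cases hjl : j = l
    · subst hjl
      simp [hij, Ne.symm hij, hself hij]
      ring
    · simp [Ne.symm hij, hkl, hjl, hshare hij hkl hjl]
  by_cases hil : i = l
  · subst hil
    by_cases hjk : j = k
    · subst hjk
      simp_rw [fun ω : Fin n → X => hsymm (ω j) (ω i)]
      simp [hij, Ne.symm hij, hself hij]
      ring
    · simp_rw [fun ω : Fin n → X => hsymm (ω k) (ω i)]
      simp [hik, Ne.symm hij, hjk, hshare hij hik hjk]
  by_cases hjk : j = k
  · subst hjk
    simp_rw [fun ω : Fin n → X => hsymm (ω i) (ω j)]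
    simp [hij, hil, hkl, hshare (Ne.symm hij) hkl hil]
  by_cases hjl : j = l
  · subst hjl
    simp_rw [fun ω : Fin n → X => hsymm (ω i) (ω j), fun ω : Fin n → X => hsymm (ω k) (ω j)]
    simp [hij, hik, hjk, hshare (Ne.symm hij) hjk hik]
  have hm : AEMeasurable (fun p : X × X => h p.1 p.2) (μ.prod μ) := hL2.aemeasurable
  have hI := (hind.indepFun_prodMk_prodMk (by fun_prop) i j k l hik hil hjk hjl).comp₀
    (φ := fun p : X × X => h p.1 p.2) (ψ := fun p : X × X => h p.1 p.2)
    (by fun_prop) (by fun_prop) (by rwa [(measurePreserving_eval_pair hij).map_eq])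
    (by rwa [(measurePreserving_eval_pair hkl).map_eq])
  have hcov : cov[fun ω : Fin n → X => h (ω i) (ω j), fun ω => h (ω k) (ω l);
      Measure.pi fun _ => μ] = 0 := hI.covariance_eq_zero (hM (i, j)) (hM (k, l))
  simpa [hik, hil, hjk, hjl] using hcov

end UStatistic

section HalfGaussian

lemma integral_relu_pow_stdGaussian (k : ℕ) (hk : k ≠ 0) :
    ∫ x, max x 0 ^ k ∂(gaussianReal 0 1) =
      (√(2 * Real.pi))⁻¹ * ((1 / 2 : ℝ) ^ (-((k : ℝ) + 1) / 2) * (1 / 2)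
        * Real.Gamma (((k : ℝ) + 1) / 2)) := by
  rw [integral_gaussianReal_eq_integral_smul one_ne_zero,
    ← integral_rpow_mul_exp_neg_mul_rpow two_pos
      (by linarith [(Nat.cast_nonneg k : (0 : ℝ) ≤ k)]) one_half_pos,
    ← integral_const_mul, ← integral_indicator measurableSet_Ioi]
  refine integral_congr_ae (Filter.Eventually.of_forall fun x => ?_)
  by_cases hx : 0 < x
  · simp [gaussianPDFReal, hx, hx.le]
    ring_nf
  · simp [hx, max_eq_right (not_lt.mp hx), hk]

lemma integral_relu_sq_stdGaussian : ∫ x, max x 0 ^ 2 ∂(gaussianReal 0 1) = 1 / 2 := by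
  have hG : Real.Gamma ((((2 : ℕ) : ℝ) + 1) / 2) = √Real.pi / 2 := by
    have := Real.Gamma_nat_add_half 1
    norm_num at this ⊢
    exact this
  have hp : (1 / 2 : ℝ) ^ (-(((2 : ℕ) : ℝ) + 1) / 2) = 2 * √2 := by
    rw [one_div, Real.inv_rpow two_pos.le, ← Real.rpow_neg two_pos.le, Real.sqrt_eq_rpow]
    nth_rewrite 3 [← Real.rpow_one 2]
    rw [← Real.rpow_add two_pos]
    norm_num
  rw [integral_relu_pow_stdGaussian 2 two_ne_zero, hG, hp, Real.sqrt_mul two_pos.le]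
  have hpi : √Real.pi ≠ 0 := by positivity
  field_simp

lemma integral_relu_pow_four_stdGaussian : ∫ x, max x 0 ^ 4 ∂(gaussianReal 0 1) = 3 / 2 := by
  have hG : Real.Gamma ((((4 : ℕ) : ℝ) + 1) / 2) = 3 * √Real.pi / 4 := by
    have := Real.Gamma_nat_add_half 2
    norm_num at this ⊢
    exact this
  have hp : (1 / 2 : ℝ) ^ (-(((4 : ℕ) : ℝ) + 1) / 2) = 4 * √2 := by
    have h4 : (4 : ℝ) = 2 ^ (2 : ℝ) := by norm_num
    rw [one_div, Real.inv_rpow two_pos.le, ← Real.rpow_neg two_pos.le, Real.sqrt_eq_rpow, h4,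
      ← Real.rpow_add two_pos]
    norm_num
  rw [integral_relu_pow_stdGaussian 4 four_ne_zero, hG, hp, Real.sqrt_mul two_pos.le]
  have hpi : √Real.pi ≠ 0 := by positivity
  field_simp

end HalfGaussian

section ReluMoments

instance inst_s15 : IsProbabilityMeasure _root_.stdGaussian :=
  inferInstanceAs (IsProbabilityMeasure (gaussianReal 0 1))

instance : IsProbabilityMeasure pairLaw :=
  inferInstanceAs (IsProbabilityMeasure (_root_.stdGaussian.prod _root_.stdGaussian))

/-- The reflection exchanging `G` and `Ĝ` preserves the law of a pair of independent standard
normals. -/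
lemma measurePreserving_reflection (θ : ℝ) :
    MeasurePreserving (fun p : ℝ × ℝ => (ghat θ p, p.1 * Real.sin θ - p.2 * Real.cos θ))
      pairLaw pairLaw := by
  have hrot : MeasurePreserving (ContinuousLinearMap.rotation (E := ℝ) θ) pairLaw
      (_root_.stdGaussian.prod _root_.stdGaussian) :=
    ⟨by fun_prop, IsGaussian.map_rotation_eq_self (μ := gaussianReal 0 1) (by simp) θ⟩
  have hneg : MeasurePreserving (fun x : ℝ => -x) _root_.stdGaussian _root_.stdGaussian :=
    ⟨by fun_prop, by simp [_root_.stdGaussian, gaussianReal_map_neg]⟩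
  convert ((MeasurePreserving.id _root_.stdGaussian).prod hneg).comp hrot using 1
  ext p
  · simp [ContinuousLinearMap.rotation_apply, ghat, mul_comm]
  · simp [ContinuousLinearMap.rotation_apply]
    ring
  · rfl

lemma ghat_reflection (θ : ℝ) (p : ℝ × ℝ) :
    ghat θ (ghat θ p, p.1 * Real.sin θ - p.2 * Real.cos θ) = p.1 := by
  simp only [ghat]
  linear_combination p.1 * Real.sin_sq_add_cos_sq θ

/-- The mixed moments `E[φ(G)^a φ(Ĝ)^b]` of the rectified pair. -/
noncomputable def reluMoment (a b : ℕ) (θ : ℝ) : ℝ :=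
  ∫ p, max p.1 0 ^ a * max (ghat θ p) 0 ^ b ∂pairLaw

lemma reluMoment_comm (a b : ℕ) (θ : ℝ) : reluMoment a b θ = reluMoment b a θ := by
  have hT := measurePreserving_reflection θ
  have hm := measurable_ghat θ
  unfold reluMoment
  conv_rhs => rw [← hT.map_eq, integral_map hT.aemeasurable
    (Measurable.aestronglyMeasurable (by fun_prop))]
  simp_rw [ghat_reflection, mul_comm]

lemma reluMoment_eq_J {a b : ℕ} (ha : a ≠ 0) (hb : b ≠ 0) (θ : ℝ) :
    reluMoment a b θ = J a b θ := by
  refine integral_congr_ae (Filter.Eventually.of_forall fun p => ?_)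
  by_cases h1 : 0 < p.1 <;> by_cases h2 : 0 < ghat θ p <;>
    simp_all [le_of_lt]

lemma reluMoment_zero_right (k : ℕ) (θ : ℝ) :
    reluMoment k 0 θ = ∫ x, max x 0 ^ k ∂(gaussianReal 0 1) := by
  simpa [reluMoment, pairLaw, _root_.stdGaussian] using integral_prod_mul (μ := _root_.stdGaussian)
    (ν := _root_.stdGaussian) (fun x : ℝ => max x 0 ^ k) (fun _ => (1 : ℝ))

lemma memLp_relu_fst (q : ENNReal) (hq : q ≠ ⊤) :
    MemLp (fun p : ℝ × ℝ => max p.1 0) q pairLaw :=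
  ((memLp_id_gaussianReal' (μ := 0) (v := 1) q hq).comp_measurePreserving
    (measurePreserving_fst (ν := _root_.stdGaussian))).pos_part

lemma memLp_relu_ghat (θ : ℝ) (q : ENNReal) (hq : q ≠ ⊤) :
    MemLp (fun p : ℝ × ℝ => max (ghat θ p) 0) q pairLaw :=
  (memLp_relu_fst q hq).comp_measurePreserving (measurePreserving_reflection θ)

lemma integrable_relu_mul_relu (a b : ℕ) (θ : ℝ) :
    Integrable (fun p => max p.1 0 ^ a * max (ghat θ p) 0 ^ b) pairLaw := by
  have h {f : ℝ × ℝ → ℝ} (hf : ∀ q : ENNReal, q ≠ ⊤ → MemLp f q pairLaw) (k : ℕ) :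
      MemLp (fun p => f p ^ k) 2 pairLaw := by
    rw [memLp_two_iff_integrable_sq (f := fun p => f p ^ k)
      ((hf 1 (by simp)).aestronglyMeasurable.pow k)]
    have := (hf ((k * 2 : ℕ) : ENNReal) (ENNReal.natCast_ne_top _)).integrable_norm_pow'
    simpa only [pow_mul, Real.norm_eq_abs, sq_abs, ← abs_pow, abs_sq] using this
  exact (h memLp_relu_fst a).integrable_mul (h (memLp_relu_ghat θ) b)

/-- The kernel of the double sum defining `S`. -/
noncomputable def crossSq (θ : ℝ) (p q : ℝ × ℝ) : ℝ :=
  (max p.1 0 * max (ghat θ q) 0 - max q.1 0 * max (ghat θ p) 0) ^ 2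

/-- The monomials `φ(G)^a φ(Ĝ)^b` of the rectified pair. -/
noncomputable def reluMonomial (θ : ℝ) (a b : ℕ) (p : ℝ × ℝ) : ℝ :=
  max p.1 0 ^ a * max (ghat θ p) 0 ^ b

lemma integrable_reluMonomial (θ : ℝ) (a b : ℕ) : Integrable (reluMonomial θ a b) pairLaw :=
  integrable_relu_mul_relu a b θ

lemma integral_reluMonomial (θ : ℝ) (a b : ℕ) :
    ∫ p, reluMonomial θ a b p ∂pairLaw = reluMoment a b θ := rfl

lemma integrable_reluMonomial_mul (θ : ℝ) (a b c d : ℕ) :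
    Integrable (fun p : (ℝ × ℝ) × (ℝ × ℝ) => reluMonomial θ a b p.1 * reluMonomial θ c d p.2)
      (pairLaw.prod pairLaw) :=
  (integrable_reluMonomial θ a b).mul_prod (integrable_reluMonomial θ c d)

lemma integral_reluMonomial_mul (θ : ℝ) (a b c d : ℕ) :
    ∫ p : (ℝ × ℝ) × (ℝ × ℝ), reluMonomial θ a b p.1 * reluMonomial θ c d p.2
      ∂(pairLaw.prod pairLaw) = reluMoment a b θ * reluMoment c d θ :=
  integral_prod_mul _ _

lemma reluMoment_two_zero (θ : ℝ) : reluMoment 2 0 θ = 1 / 2 := by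
  rw [reluMoment_zero_right, integral_relu_sq_stdGaussian]

lemma reluMoment_four_zero (θ : ℝ) : reluMoment 4 0 θ = 3 / 2 := by
  rw [reluMoment_zero_right, integral_relu_pow_four_stdGaussian]

lemma measurable_crossSq (θ : ℝ) :
    Measurable fun p : (ℝ × ℝ) × (ℝ × ℝ) => crossSq θ p.1 p.2 := by
  have := measurable_ghat θ
  unfold crossSq
  fun_prop

lemma crossSq_sq_eq (θ : ℝ) : (fun p : (ℝ × ℝ) × (ℝ × ℝ) => crossSq θ p.1 p.2 ^ 2) = fun p =>
    reluMonomial θ 4 0 p.1 * reluMonomial θ 0 4 p.2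
      - 4 * (reluMonomial θ 3 1 p.1 * reluMonomial θ 1 3 p.2)
      + 6 * (reluMonomial θ 2 2 p.1 * reluMonomial θ 2 2 p.2)
      - 4 * (reluMonomial θ 1 3 p.1 * reluMonomial θ 3 1 p.2)
      + reluMonomial θ 0 4 p.1 * reluMonomial θ 4 0 p.2 := by
  ext p
  simp only [crossSq, reluMonomial]
  ring

lemma memLp_crossSq (θ : ℝ) :
    MemLp (fun p : (ℝ × ℝ) × (ℝ × ℝ) => crossSq θ p.1 p.2) 2 (pairLaw.prod pairLaw) := by
  rw [memLp_two_iff_integrable_sq (measurable_crossSq θ).aestronglyMeasurable, crossSq_sq_eq]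
  have h := integrable_reluMonomial_mul θ
  exact ((((h 4 0 0 4).sub' ((h 3 1 1 3).const_mul 4)).fun_add ((h 2 2 2 2).const_mul 6)).sub'
    ((h 1 3 3 1).const_mul 4)).fun_add (h 0 4 4 0)

lemma variance_crossSq (θ : ℝ) :
    Var[fun p : (ℝ × ℝ) × (ℝ × ℝ) => crossSq θ p.1 p.2; pairLaw.prod pairLaw] =
      9 / 2 - 8 * J 3 1 θ ^ 2 + 6 * J 2 2 θ ^ 2 - (1 / 2 - 2 * J 1 1 θ ^ 2) ^ 2 := by
  have h := integrable_reluMonomial_mul θ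
  have h2 : ∫ p : (ℝ × ℝ) × (ℝ × ℝ), crossSq θ p.1 p.2 ^ 2 ∂(pairLaw.prod pairLaw) =
      9 / 2 - 8 * J 3 1 θ ^ 2 + 6 * J 2 2 θ ^ 2 := by
    rw [crossSq_sq_eq, integral_add ((((h 4 0 0 4).sub' ((h 3 1 1 3).const_mul 4)).fun_add
      ((h 2 2 2 2).const_mul 6)).sub' ((h 1 3 3 1).const_mul 4)) (h 0 4 4 0),
      integral_sub (((h 4 0 0 4).sub' ((h 3 1 1 3).const_mul 4)).fun_add
      ((h 2 2 2 2).const_mul 6)) ((h 1 3 3 1).const_mul 4),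
      integral_add ((h 4 0 0 4).sub' ((h 3 1 1 3).const_mul 4)) ((h 2 2 2 2).const_mul 6),
      integral_sub (h 4 0 0 4) ((h 3 1 1 3).const_mul 4)]
    simp_rw [integral_const_mul, integral_reluMonomial_mul, reluMoment_comm 0 4,
      reluMoment_comm 1 3, reluMoment_four_zero,
      reluMoment_eq_J three_ne_zero one_ne_zero, reluMoment_eq_J two_ne_zero two_ne_zero]
    ring
  have h1 : ∫ p : (ℝ × ℝ) × (ℝ × ℝ), crossSq θ p.1 p.2 ∂(pairLaw.prod pairLaw) =
      1 / 2 - 2 * J 1 1 θ ^ 2 := by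
    have he : (fun p : (ℝ × ℝ) × (ℝ × ℝ) => crossSq θ p.1 p.2) = fun p =>
        reluMonomial θ 2 0 p.1 * reluMonomial θ 0 2 p.2
          + reluMonomial θ 0 2 p.1 * reluMonomial θ 2 0 p.2
          - 2 * (reluMonomial θ 1 1 p.1 * reluMonomial θ 1 1 p.2) := by
      ext p
      simp only [crossSq, reluMonomial]
      ring
    rw [he, integral_sub ((h 2 0 0 2).fun_add (h 0 2 2 0)) ((h 1 1 1 1).const_mul 2),
      integral_add (h 2 0 0 2) (h 0 2 2 0)]
    simp_rw [integral_const_mul, integral_reluMonomial_mul, reluMoment_comm 0 2,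
      reluMoment_two_zero, reluMoment_eq_J one_ne_zero one_ne_zero]
    ring
  rw [variance_eq_sub (memLp_crossSq θ), h1, ← h2]
  rfl

lemma integral_crossSq_right (θ : ℝ) :
    (fun p => ∫ q, crossSq θ p q ∂pairLaw) = fun p => 1 / 2 * reluMonomial θ 2 0 p
      + 1 / 2 * reluMonomial θ 0 2 p - 2 * J 1 1 θ * reluMonomial θ 1 1 p := by
  ext p
  have h := integrable_reluMonomial θ
  have he : (fun q => crossSq θ p q) = fun q => reluMonomial θ 2 0 p * reluMonomial θ 0 2 q
      + reluMonomial θ 0 2 p * reluMonomial θ 2 0 q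
      - 2 * reluMonomial θ 1 1 p * reluMonomial θ 1 1 q := by
    ext q
    simp only [crossSq, reluMonomial]
    ring
  rw [he, integral_sub (((h 0 2).const_mul _).fun_add ((h 2 0).const_mul _)) ((h 1 1).const_mul _),
    integral_add ((h 0 2).const_mul _) ((h 2 0).const_mul _)]
  simp_rw [integral_const_mul, integral_reluMonomial, reluMoment_comm 0 2, reluMoment_two_zero,
    reluMoment_eq_J one_ne_zero one_ne_zero]
  ring

lemma integral_crossSq_right_sq_eq (θ : ℝ) :
    (fun p => (∫ q, crossSq θ p q ∂pairLaw) ^ 2) = fun p => 1 / 4 * reluMonomial θ 4 0 p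
      + 1 / 4 * reluMonomial θ 0 4 p + (4 * J 1 1 θ ^ 2 + 1 / 2) * reluMonomial θ 2 2 p
      - 2 * J 1 1 θ * reluMonomial θ 3 1 p - 2 * J 1 1 θ * reluMonomial θ 1 3 p := by
  ext p
  rw [congrFun (integral_crossSq_right θ) p]
  simp only [reluMonomial]
  ring

lemma memLp_integral_crossSq_right (θ : ℝ) :
    MemLp (fun p => ∫ q, crossSq θ p q ∂pairLaw) 2 pairLaw := by
  have h := integrable_reluMonomial θ
  rw [memLp_two_iff_integrable_sq, integral_crossSq_right_sq_eq]
  · exact (((((h 4 0).const_mul _).fun_add ((h 0 4).const_mul _)).fun_add ((h 2 2).const_mul _)).sub'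
      ((h 3 1).const_mul _)).sub' ((h 1 3).const_mul _)
  · rw [integral_crossSq_right]
    exact ((((h 2 0).const_mul _).fun_add ((h 0 2).const_mul _)).sub' ((h 1 1).const_mul _)).1

lemma variance_integral_crossSq_right (θ : ℝ) :
    Var[fun p => ∫ q, crossSq θ p q ∂pairLaw; pairLaw] =
      1 / 2 * (-8 * J 1 1 θ ^ 4 + 8 * J 1 1 θ ^ 2 * J 2 2 θ + 4 * J 1 1 θ ^ 2
          - 8 * J 1 1 θ * J 3 1 θ + J 2 2 θ + 1) := by
  have h := integrable_reluMonomial θ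
  have h2 : ∫ p, (∫ q, crossSq θ p q ∂pairLaw) ^ 2 ∂pairLaw =
      3 / 4 + (4 * J 1 1 θ ^ 2 + 1 / 2) * J 2 2 θ - 4 * J 1 1 θ * J 3 1 θ := by
    rw [integral_crossSq_right_sq_eq, integral_sub (((((h 4 0).const_mul _).fun_add
      ((h 0 4).const_mul _)).fun_add ((h 2 2).const_mul _)).sub' ((h 3 1).const_mul _))
      ((h 1 3).const_mul _), integral_sub ((((h 4 0).const_mul _).fun_add
      ((h 0 4).const_mul _)).fun_add ((h 2 2).const_mul _)) ((h 3 1).const_mul _),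
      integral_add (((h 4 0).const_mul _).fun_add ((h 0 4).const_mul _)) ((h 2 2).const_mul _),
      integral_add ((h 4 0).const_mul _) ((h 0 4).const_mul _)]
    simp_rw [integral_const_mul, integral_reluMonomial, reluMoment_comm 0 4,
      reluMoment_comm 1 3, reluMoment_four_zero,
      reluMoment_eq_J three_ne_zero one_ne_zero, reluMoment_eq_J two_ne_zero two_ne_zero]
    ring
  have h1 : ∫ p, ∫ q, crossSq θ p q ∂pairLaw ∂pairLaw = 1 / 2 - 2 * J 1 1 θ ^ 2 := by
    rw [integral_crossSq_right, integral_sub (((h 2 0).const_mul _).fun_add ((h 0 2).const_mul _))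
      ((h 1 1).const_mul _), integral_add ((h 2 0).const_mul _) ((h 0 2).const_mul _)]
    simp_rw [integral_const_mul, integral_reluMonomial, reluMoment_comm 0 2,
      reluMoment_two_zero, reluMoment_eq_J one_ne_zero one_ne_zero]
    ring
  rw [variance_eq_sub (memLp_integral_crossSq_right θ), h1]
  simp only [Pi.pow_apply, h2]
  ring

end ReluMoments

/-- Exact formula for `Var[S]` in terms of the mixed moments `J_{a,b}(θ)`. -/
theorem variance_S (n : ℕ) (hn : 1 ≤ n) (θ : ℝ) (hθ : θ ∈ Set.Icc 0 Real.pi) :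
    variance (Sfun n θ) (piMeasure n) =
      8 / n * (-8 * J 1 1 θ ^ 4 + 8 * J 1 1 θ ^ 2 * J 2 2 θ + 4 * J 1 1 θ ^ 2
          - 8 * J 1 1 θ * J 3 1 θ + J 2 2 θ + 1)
      + 2 / (n : ℝ) ^ 2 *
          (80 * J 1 1 θ ^ 4 - 96 * J 1 1 θ ^ 2 * J 2 2 θ - 40 * J 1 1 θ ^ 2
            + 96 * J 1 1 θ * J 3 1 θ + 24 * J 2 2 θ ^ 2 - 12 * J 2 2 θ
            - 32 * J 3 1 θ ^ 2 + 5)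
      + 2 / (n : ℝ) ^ 3 *
          (-48 * J 1 1 θ ^ 4 + 64 * J 1 1 θ ^ 2 * J 2 2 θ + 24 * J 1 1 θ ^ 2
            - 64 * J 1 1 θ * J 3 1 θ - 24 * J 2 2 θ ^ 2 + 8 * J 2 2 θ
            + 32 * J 3 1 θ ^ 2 - 9) := by
  have hn0 : (n : ℝ) ≠ 0 := by positivity
  have hsum := variance_sum_kernel (h := crossSq θ) (μ := pairLaw)
    (fun p q => by simp only [crossSq]; ring) (fun p => by simp [crossSq])
    (memLp_crossSq θ) (memLp_integral_crossSq_right θ) n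
  rw [variance_crossSq, variance_integral_crossSq_right] at hsum
  have hS := variance_const_mul (2 / (n : ℝ) ^ 2)
    (fun ω : Fin n → ℝ × ℝ => ∑ i, ∑ j, crossSq θ (ω i) (ω j)) (piMeasure n)
  rw [piMeasure, hsum] at hS
  refine hS.trans ?_
  field_simp
  ring
end

section
/- Let f : ℝ² → ℝ be a measurable function with E[f(G, Ĝ)⁴] < ∞, where (G, Ĝ) is a standard Gaussian pair with correlation cos θ. For each n ≥ 1 let A_n := (1/n²) Σ_{i=1}^{n} Σ_{j=1}^{n} f(G_i, Ĝ_j). Then there exists a constant C (depending only on f and θ) such that for all n ≥ 1, |E[(A_n − E[A_n])³]| ≤ C/n² and E[(A_n − E[A_n])⁴] ≤ C/n². -/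
open MeasureTheory ProbabilityTheory

/-- `A_n = (1/n²) Σ_{i,j} f(G_i, Ĝ_j)`. -/
noncomputable def Afun (n : ℕ) (θ : ℝ) (f : ℝ × ℝ → ℝ) (ω : Fin n → ℝ × ℝ) : ℝ :=
  1 / (n : ℝ) ^ 2 * ∑ i : Fin n, ∑ j : Fin n, f ((ω i).1, ghat θ (ω j))

/-- Two independent coincidences among the values of a function cost two degrees of freedom. -/
theorem card_filter_two_coincidences {V α : Type*} [Fintype V] [DecidableEq V] [Fintype α]
    [DecidableEq α] {v v' w w' : V} (hv : v ≠ v') (hw : w ≠ w') (hwv : w ≠ v) (hwv' : w ≠ v') :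
    (Finset.univ.filter fun c : V → α => c v = c v' ∧ c w = c w').card
      ≤ Fintype.card α ^ (Fintype.card V - 2) := by
  have hcard : Fintype.card ({x // x ∉ ({v, w} : Finset V)} → α)
      = Fintype.card α ^ (Fintype.card V - 2) := by
    rw [Fintype.card_fun, Fintype.card_subtype_compl, Fintype.card_coe,
      Finset.card_pair hwv.symm]
  rw [← hcard, ← Finset.card_univ]
  refine Finset.card_le_card_of_injOn (fun c x => c x) (fun _ _ => Finset.mem_univ _) ?_
  intro c hc d hd hcd
  simp only [Finset.coe_filter, Finset.mem_univ, true_and, Set.mem_ofPred_eq] at hc hd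
  have off : ∀ x, x ≠ v → x ≠ w → c x = d x := fun x hxv hxw =>
    congrFun hcd ⟨x, by simp [hxv, hxw]⟩
  have hv_eq : c v = d v := by rw [hc.1, hd.1, off v' hv.symm hwv'.symm]
  have hw_eq : c w = d w := by
    rw [hc.2, hd.2]
    by_cases h : w' = v
    · rw [h, hv_eq]
    · exact off w' h hw.symm
  funext x
  by_cases hxv : x = v
  · rw [hxv, hv_eq]
  by_cases hxw : x = w
  · rw [hxw, hw_eq]
  exact off x hxv hxw

/-- Most `p`-tuples of pairs contain a pair sharing no entry with the others. -/
theorem card_filter_no_isolated_pair {α : Type*} [Fintype α] [DecidableEq α] {p : ℕ}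
    (hp : 3 ≤ p) :
    (Finset.univ.filter fun t : Fin p → α × α =>
        ∀ k, ∃ l, l ≠ k ∧ ¬ Disjoint ({(t k).1, (t k).2} : Finset α) {(t l).1, (t l).2}).card
      ≤ (2 * p) ^ 4 * Fintype.card α ^ (2 * p - 2) := by
  let V := Fin p × Bool
  have hV : Fintype.card V = 2 * p := by simp [V, mul_comm]
  let flat : (Fin p → α × α) → V → α := fun t x => bif x.2 then (t x.1).1 else (t x.1).2
  let good : Finset ((V × V) × V × V) := Finset.univ.filter fun q =>
    q.1.1 ≠ q.1.2 ∧ q.2.1 ≠ q.2.2 ∧ q.2.1 ≠ q.1.1 ∧ q.2.1 ≠ q.1.2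
  have share : ∀ (t : Fin p → α × α) k l,
      ¬ Disjoint ({(t k).1, (t k).2} : Finset α) {(t l).1, (t l).2} →
      ∃ b b', flat t (k, b) = flat t (l, b') := by
    intro t k l h
    obtain ⟨x, hx, hx'⟩ := Finset.not_disjoint_iff.1 h
    simp only [Finset.mem_insert, Finset.mem_singleton] at hx hx'
    rcases hx with hx | hx <;> rcases hx' with hx' | hx'
    · exact ⟨true, true, hx.symm.trans hx'⟩
    · exact ⟨true, false, hx.symm.trans hx'⟩
    · exact ⟨false, true, hx.symm.trans hx'⟩
    · exact ⟨false, false, hx.symm.trans hx'⟩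
  calc _ ≤ (good.biUnion fun q => Finset.univ.filter fun c : V → α =>
          c q.1.1 = c q.1.2 ∧ c q.2.1 = c q.2.2).card := by
        refine Finset.card_le_card_of_injOn flat ?_ ?_
        · intro t ht
          simp only [Finset.coe_filter, Finset.mem_univ, true_and, Set.mem_ofPred_eq] at ht
          obtain ⟨l, hl, hl'⟩ := ht ⟨0, by omega⟩
          obtain ⟨m, -, hm⟩ := Finset.exists_mem_notMem_of_card_lt_card
            (s := ({⟨0, by omega⟩, l} : Finset (Fin p))) (t := Finset.univ)
            (Finset.card_le_two.trans_lt (by rw [Finset.card_univ, Fintype.card_fin]; omega))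
          simp only [Finset.mem_insert, Finset.mem_singleton, not_or] at hm
          obtain ⟨m', hm', hm''⟩ := ht m
          obtain ⟨b, b', h⟩ := share t _ _ hl'
          obtain ⟨d, d', h'⟩ := share t _ _ hm''
          refine Finset.mem_biUnion.2 ⟨(((⟨0, by omega⟩, b), (l, b')), ((m, d), (m', d'))), ?_,
            Finset.mem_filter.2 ⟨Finset.mem_univ _, h, h'⟩⟩
          exact Finset.mem_filter.2 ⟨Finset.mem_univ _, fun e => hl (congrArg Prod.fst e).symm,
            fun e => hm' (congrArg Prod.fst e).symm, fun e => hm.1 (congrArg Prod.fst e),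
            fun e => hm.2 (congrArg Prod.fst e)⟩
        · intro t _ t' _ h
          funext k
          exact Prod.ext (congrFun h (k, true)) (congrFun h (k, false))
    _ ≤ good.card * Fintype.card α ^ (2 * p - 2) := by
        refine Finset.card_biUnion_le_card_mul _ _ _ fun q hq => ?_
        obtain ⟨h1, h2, h3, h4⟩ := (Finset.mem_filter.1 hq).2
        exact hV ▸ card_filter_two_coincidences h1 h2 h3 h4
    _ ≤ (2 * p) ^ 4 * Fintype.card α ^ (2 * p - 2) := by
        refine Nat.mul_le_mul_right _ ((Finset.card_le_univ _).trans_eq ?_)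
        rw [Fintype.card_prod, Fintype.card_prod, hV]; ring

theorem abs_prod_le_sum_pow {p : ℕ} (hp : p ≠ 0) (x : Fin p → ℝ) :
    |∏ k, x k| ≤ ∑ k, |x k| ^ p := by
  have : Nonempty (Fin p) := Fin.pos_iff_nonempty.1 (Nat.pos_of_ne_zero hp)
  obtain ⟨m, hm⟩ := Finite.exists_max fun k => |x k|
  rw [Finset.abs_prod]
  calc ∏ k, |x k| ≤ ∏ _k : Fin p, |x m| :=
        Finset.prod_le_prod (fun _ _ => abs_nonneg _) fun k _ => hm k
    _ = |x m| ^ p := by simp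
    _ ≤ ∑ k, |x k| ^ p :=
        Finset.single_le_sum (f := fun k => |x k| ^ p) (fun _ _ => by positivity)
          (Finset.mem_univ m)

/-- A moment bound for sums of random variables indexed by pairs, where a product has zero mean
as soon as one of its factors has a pair of indices disjoint from all the others. -/
theorem abs_integral_sum_pow_le {Ω α : Type*} [MeasurableSpace Ω] {P : Measure Ω}
    [Fintype α] [DecidableEq α] {p : ℕ} (hp : 3 ≤ p) {X : α × α → Ω → ℝ} {M : ℝ}
    (hX : ∀ a, AEStronglyMeasurable (X a) P) (hint : ∀ a, Integrable (fun ω => |X a ω| ^ p) P)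
    (hM : ∀ a, ∫ ω, |X a ω| ^ p ∂P ≤ M)
    (hzero : ∀ (t : Fin p → α × α) (k : Fin p),
      (∀ l, l ≠ k → Disjoint ({(t k).1, (t k).2} : Finset α) {(t l).1, (t l).2}) →
      ∫ ω, ∏ k, X (t k) ω ∂P = 0) :
    |∫ ω, (∑ a, X a ω) ^ p ∂P| ≤ (2 * p) ^ 4 * p * M * (Fintype.card α : ℝ) ^ (2 * p - 2) := by
  have hsumint : ∀ t : Fin p → α × α, Integrable (fun ω => ∑ k, |X (t k) ω| ^ p) P :=
    fun t => integrable_finsetSum _ fun k _ => hint (t k)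
  have hprodint : ∀ t : Fin p → α × α, Integrable (fun ω => ∏ k, X (t k) ω) P := fun t =>
    (hsumint t).mono' (Finset.aestronglyMeasurable_fun_prod _ fun k _ => hX (t k))
      (.of_forall fun ω => abs_prod_le_sum_pow (by omega) _)
  have hbound : ∀ t : Fin p → α × α, |∫ ω, ∏ k, X (t k) ω ∂P| ≤ p * M := fun t =>
    calc |∫ ω, ∏ k, X (t k) ω ∂P| ≤ ∫ ω, |∏ k, X (t k) ω| ∂P := abs_integral_le_integral_abs
      _ ≤ ∫ ω, ∑ k, |X (t k) ω| ^ p ∂P :=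
          integral_mono (hprodint t).abs (hsumint t) fun ω => abs_prod_le_sum_pow (by omega) _
      _ = ∑ k, ∫ ω, |X (t k) ω| ^ p ∂P := integral_finsetSum _ fun k _ => hint (t k)
      _ ≤ ∑ _k : Fin p, M := Finset.sum_le_sum fun k _ => hM (t k)
      _ = p * M := by simp
  simp_rw [Fintype.sum_pow]
  rw [integral_finsetSum _ fun t _ => hprodint t]
  set B := Finset.univ.filter fun t : Fin p → α × α =>
    ∀ k, ∃ l, l ≠ k ∧ ¬ Disjoint ({(t k).1, (t k).2} : Finset α) {(t l).1, (t l).2} with hB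
  rw [← Finset.sum_subset (Finset.subset_univ B)]
  · rcases isEmpty_or_nonempty α with hα | hα
    · have : B = ∅ := by
        ext t
        exact (hα.false (t ⟨0, by omega⟩).1).elim
      rw [this, Fintype.card_eq_zero]
      simp [show 2 * p - 2 ≠ 0 by omega]
    have hM0 : 0 ≤ M := by
      obtain ⟨a⟩ := hα
      exact (integral_nonneg fun ω => by positivity).trans (hM (a, a))
    calc |∑ t ∈ B, ∫ ω, ∏ k, X (t k) ω ∂P| ≤ ∑ t ∈ B, |∫ ω, ∏ k, X (t k) ω ∂P| :=
          Finset.abs_sum_le_sum_abs _ _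
      _ ≤ ∑ _t ∈ B, p * M := Finset.sum_le_sum fun t _ => hbound t
      _ = B.card * (p * M) := by rw [Finset.sum_const, nsmul_eq_mul]
      _ ≤ ((2 * p) ^ 4 * Fintype.card α ^ (2 * p - 2) : ℕ) * (p * M) := by
          gcongr
          exact card_filter_no_isolated_pair hp
      _ = _ := by push_cast; ring
  · intro t _ ht
    simp only [hB, Finset.mem_filter, Finset.mem_univ, true_and, not_forall, not_exists, not_and,
      not_not] at ht
    exact ht.elim fun k hk => hzero t k hk

section PiMeasure

variable {ι E : Type*} [Fintype ι] [MeasurableSpace E] {μ : Measure E} [IsProbabilityMeasure μ]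

/-- Resampling one coordinate preserves an i.i.d. product measure. -/
theorem measurePreserving_update_pi [DecidableEq ι] (i : ι) :
    MeasurePreserving (fun q : (ι → E) × E => Function.update q.1 i q.2)
      ((Measure.pi fun _ => μ).prod μ) (Measure.pi fun _ => μ) := by
  have hmeas : Measurable fun q : (ι → E) × E => Function.update q.1 i q.2 := by
    refine measurable_pi_lambda _ fun j => ?_
    by_cases h : j = i
    · subst h; simpa using measurable_snd
    · simpa [Function.update_of_ne h, Function.comp_def] using
        (measurable_pi_apply j).comp measurable_fst
  refine ⟨hmeas, (Measure.pi_eq fun s hs => ?_).symm⟩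
  have hpre : (fun q : (ι → E) × E => Function.update q.1 i q.2) ⁻¹' Set.univ.pi s
      = Set.univ.pi (Function.update s i Set.univ) ×ˢ s i := by
    ext ⟨ω, x⟩
    simp only [Set.mem_preimage, Set.mem_univ_pi, Set.mem_prod]
    constructor
    · intro h
      refine ⟨fun j => ?_, by simpa using h i⟩
      by_cases hj : j = i
      · subst hj; simp
      · simpa [Function.update_of_ne hj] using h j
    · rintro ⟨h, hx⟩ j
      by_cases hj : j = i
      · subst hj; simpa using hx
      · simpa [Function.update_of_ne hj] using h j
  rw [Measure.map_apply hmeas (.univ_pi hs), hpre, Measure.prod_prod, Measure.pi_pi,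
    Fintype.prod_eq_mul_prod_compl i, Fintype.prod_eq_mul_prod_compl i fun j => μ (s j)]
  simp only [Function.update_self, measure_univ, one_mul]
  rw [mul_comm]
  congr 1
  refine Finset.prod_congr rfl fun j hj => ?_
  rw [Function.update_of_ne (by simpa using hj)]

/-- Two distinct coordinates of an i.i.d. product measure have the product law. -/
theorem measurePreserving_pi_pair {i j : ι} (hij : i ≠ j) :
    MeasurePreserving (fun ω : ι → E => (ω i, ω j)) (Measure.pi fun _ => μ) (μ.prod μ) := by
  refine ⟨by fun_prop, ?_⟩
  have hind : iIndepFun (fun (i : ι) (ω : ι → E) => ω i) (Measure.pi fun _ => μ) :=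
    iIndepFun_pi (X := fun _ x => x) fun _ => aemeasurable_id
  rw [(indepFun_iff_map_prod_eq_prod_map_map (measurable_pi_apply i).aemeasurable
    (measurable_pi_apply j).aemeasurable).1
    (hind.indepFun hij), (measurePreserving_eval (fun _ => μ) i).map_eq,
    (measurePreserving_eval (fun _ => μ) j).map_eq]

/-- A product of centred functions of pairs of i.i.d. variables has zero mean as soon as one pair
is disjoint from the others. -/
theorem integral_prod_pair_eq_zero [DecidableEq ι] {κ : Type*} [Fintype κ] [DecidableEq κ]
    {g : ι × ι → E × E → ℝ} (hg : ∀ a, Measurable (g a)) (t : κ → ι × ι) (k : κ)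
    (hk : ∀ l, l ≠ k → Disjoint ({(t k).1, (t k).2} : Finset ι) {(t l).1, (t l).2})
    (hzero : ∫ ω : ι → E, g (t k) (ω (t k).1, ω (t k).2) ∂Measure.pi (fun _ => μ) = 0) :
    ∫ ω : ι → E, ∏ l, g (t l) (ω (t l).1, ω (t l).2) ∂Measure.pi (fun _ => μ) = 0 := by
  have hind : iIndepFun (fun (i : ι) (ω : ι → E) => ω i) (Measure.pi fun _ => μ) :=
    iIndepFun_pi (X := fun _ x => x) fun _ => aemeasurable_id
  set S : Finset ι := {(t k).1, (t k).2} with hS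
  have h1 : (t k).1 ∈ S := by simp [hS]
  have h2 : (t k).2 ∈ S := by simp [hS]
  have h3 : ∀ l : {l // l ≠ k}, (t l).1 ∈ Sᶜ := fun l =>
    Finset.mem_compl.2 (Finset.disjoint_right.1 (hk l l.2) (by simp))
  have h4 : ∀ l : {l // l ≠ k}, (t l).2 ∈ Sᶜ := fun l =>
    Finset.mem_compl.2 (Finset.disjoint_right.1 (hk l l.2) (by simp))
  have hφ : Measurable fun u : S → E => g (t k) (u ⟨_, h1⟩, u ⟨_, h2⟩) :=
    (hg _).comp (by fun_prop)
  have hψ : Measurable fun u : (Sᶜ : Finset ι) → E =>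
      ∏ l : {l // l ≠ k}, g (t l) (u ⟨_, h3 l⟩, u ⟨_, h4 l⟩) :=
    Finset.measurable_fun_prod _ fun l _ => (hg _).comp (by fun_prop)
  have hIndep := (hind.indepFun_finset S Sᶜ disjoint_compl_right
    fun i => measurable_pi_apply i).comp hφ hψ
  have hmul := hIndep.integral_fun_mul_eq_mul_integral
    (hφ.comp (by fun_prop)).aestronglyMeasurable (hψ.comp (by fun_prop)).aestronglyMeasurable
  simp_rw [Fintype.prod_eq_mul_prod_subtype_ne _ k]
  refine hmul.trans ?_
  simp only [Function.comp_def]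
  rw [hzero, zero_mul]

end PiMeasure

theorem MeasureTheory.MeasurePreserving.integral_comp_of_measurable {Ω Ω' : Type*}
    [MeasurableSpace Ω] [MeasurableSpace Ω'] {P : Measure Ω} {Q : Measure Ω'} {φ : Ω → Ω'}
    (hφ : MeasurePreserving φ P Q) {g : Ω' → ℝ} (hg : Measurable g) :
    ∫ ω, g (φ ω) ∂P = ∫ x, g x ∂Q := by
  rw [← hφ.map_eq, integral_map hφ.aemeasurable hg.aestronglyMeasurable]

/-- Almost every section of an `L^p` function on a product is `L^p`; in particular one is. -/
theorem MeasureTheory.MemLp.exists_section {Ω F : Type*} [MeasurableSpace Ω] [MeasurableSpace F]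
    {P : Measure Ω} {ν : Measure F} [IsProbabilityMeasure P] [SFinite ν] {p : ℕ} (hp : p ≠ 0)
    {g : Ω × F → ℝ} (hg : Measurable g) (h : MemLp g p (P.prod ν)) :
    ∃ ω, MemLp (fun x => g (ω, x)) p ν := by
  obtain ⟨ω, hω⟩ := (h.integrable_norm_pow hp).prod_right_ae.exists
  refine ⟨ω, ?_⟩
  have hgω : Measurable fun x => g (ω, x) := hg.comp measurable_prodMk_left
  rw [← integrable_norm_rpow_iff hgω.aestronglyMeasurable (by exact_mod_cast hp) (by simp)]
  simpa using hω

section PairSum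

variable {ι E : Type*} [Fintype ι] [MeasurableSpace E] {μ : Measure E} [IsProbabilityMeasure μ]
  {h : E × E → ℝ} {p : ℕ}

theorem memLp_pair (hdiag : MemLp (fun x => h (x, x)) p μ)
    (hoff : MemLp h p (μ.prod μ)) (i j : ι) :
    MemLp (fun ω : ι → E => h (ω i, ω j)) p (Measure.pi fun _ => μ) := by
  by_cases hij : i = j
  · subst hij
    exact hdiag.comp_measurePreserving (measurePreserving_eval (fun _ => μ) i)
  · exact hoff.comp_measurePreserving (measurePreserving_pi_pair hij)

/-- Central moments of order `p ≥ 3` of a pair average are `O(n⁻²)` when the kernel is `L^p`. -/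
theorem exists_bound_centralMoment_of_memLp (hp : 3 ≤ p) (hh : Measurable h)
    (hdiag : MemLp (fun x => h (x, x)) p μ) (hoff : MemLp h p (μ.prod μ)) :
    ∃ C : ℝ, ∀ n : ℕ, 1 ≤ n →
      |∫ ω : Fin n → E, (1 / (n : ℝ) ^ 2 * ∑ i, ∑ j, h (ω i, ω j)
          - ∫ ω' : Fin n → E, 1 / (n : ℝ) ^ 2 * ∑ i, ∑ j, h (ω' i, ω' j)
              ∂Measure.pi fun _ => μ) ^ p ∂Measure.pi fun _ => μ| ≤ C / (n : ℝ) ^ 2 := by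
  have hp1 : (1 : ENNReal) ≤ p := by exact_mod_cast (by omega : 1 ≤ p)
  set M := max (∫ x, |h (x, x) - ∫ y, h (y, y) ∂μ| ^ p ∂μ)
    (∫ z, |h z - ∫ w, h w ∂μ.prod μ| ^ p ∂μ.prod μ) with hM
  obtain ⟨C, hC⟩ : ∃ C : ℝ, C = (2 * p) ^ 4 * p * M := ⟨_, rfl⟩
  refine ⟨C, fun n hn => ?_⟩
  have hn0 : (n : ℝ) ≠ 0 := by exact_mod_cast (by omega : n ≠ 0)
  set P : Measure (Fin n → E) := Measure.pi fun _ => μ with hP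
  set m : Fin n × Fin n → ℝ := fun a => ∫ ω, h (ω a.1, ω a.2) ∂P with hm
  have hLp : ∀ a : Fin n × Fin n, MemLp (fun ω => h (ω a.1, ω a.2)) p P :=
    fun a => memLp_pair hdiag hoff a.1 a.2
  have hLp' : ∀ a : Fin n × Fin n, MemLp (fun ω => h (ω a.1, ω a.2) - m a) p P :=
    fun a => (hLp a).sub (memLp_const _)
  have hcentre : ∀ ω : Fin n → E, 1 / (n : ℝ) ^ 2 * ∑ i, ∑ j, h (ω i, ω j)
      - ∫ ω', 1 / (n : ℝ) ^ 2 * ∑ i, ∑ j, h (ω' i, ω' j) ∂P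
      = 1 / (n : ℝ) ^ 2 * ∑ a : Fin n × Fin n, (h (ω a.1, ω a.2) - m a) := by
    intro ω
    simp_rw [← Fintype.sum_prod_type' fun i j => h (_, _)]
    rw [integral_const_mul, integral_finsetSum _ fun a _ => (hLp a).integrable hp1,
      Finset.sum_sub_distrib, mul_sub]
  simp_rw [hcentre, mul_pow]
  rw [integral_const_mul, abs_mul]
  have key := abs_integral_sum_pow_le (P := P) hp
    (X := fun (a : Fin n × Fin n) ω => h (ω a.1, ω a.2) - m a) (M := M)
    (fun a => (hLp' a).aestronglyMeasurable)
    (fun a => (hLp' a).integrable_norm_pow (by omega)) ?_ ?_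
  · rw [Fintype.card_fin, ← hC] at key
    calc _ ≤ |(1 / (n : ℝ) ^ 2) ^ p| * (C * (n : ℝ) ^ (2 * p - 2)) := by gcongr
      _ = C / (n : ℝ) ^ 2 := by
        rw [abs_of_nonneg (by positivity), div_pow, one_pow, ← pow_mul,
          show (n : ℝ) ^ (2 * p) = (n : ℝ) ^ (2 * p - 2) * (n : ℝ) ^ 2 by
            rw [← pow_add]; congr 1; omega]
        field_simp
  · rintro ⟨i, j⟩
    by_cases hij : i = j
    · subst hij
      have hpres := measurePreserving_eval (fun _ : Fin n => μ) i
      have hd : Measurable fun x => h (x, x) := hh.comp (by fun_prop)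
      have hmi : m (i, i) = ∫ y, h (y, y) ∂μ := hpres.integral_comp_of_measurable hd
      have := hpres.integral_comp_of_measurable
        (g := fun x => |h (x, x) - m (i, i)| ^ p) (by fun_prop)
      refine (this.trans ?_).le.trans (le_max_left _ _)
      rw [hmi]
    · have hpres := measurePreserving_pi_pair (μ := μ) hij
      have hmi : m (i, j) = ∫ w, h w ∂μ.prod μ := hpres.integral_comp_of_measurable hh
      have := hpres.integral_comp_of_measurable (g := fun x => |h x - m (i, j)| ^ p) (by fun_prop)
      refine (this.trans ?_).le.trans (le_max_right _ _)
      rw [hmi]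
  · intro t k hk
    refine integral_prod_pair_eq_zero (g := fun a z => h z - m a) (fun a => by fun_prop) t k hk ?_
    rw [integral_sub ((hLp _).integrable hp1) (integrable_const _)]
    simp [hm, hP]

theorem sum_sum_eq_of_symm [DecidableEq ι] {g : ι → ι → ℝ} (hg : ∀ i j, g i j = g j i)
    {i j : ι} (hij : i ≠ j) :
    ∑ k, ∑ l, g k l = g i i + g j j + 2 * (g i j
      + ∑ l ∈ (Finset.univ.erase i).erase j, g i l + ∑ l ∈ (Finset.univ.erase i).erase j, g j l)
      + ∑ k ∈ (Finset.univ.erase i).erase j, ∑ l ∈ (Finset.univ.erase i).erase j, g k l := by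
  have split : ∀ F : ι → ℝ,
      ∑ k, F k = F i + (F j + ∑ k ∈ (Finset.univ.erase i).erase j, F k) := fun F => by
    rw [Finset.add_sum_erase _ _ (by simp [hij.symm]), Finset.add_sum_erase _ _ (by simp)]
  simp_rw [split]
  rw [Finset.sum_add_distrib, Finset.sum_add_distrib, hg j i,
    Finset.sum_congr rfl fun k _ => hg k i, Finset.sum_congr rfl fun k _ => hg k j]
  ring

/-- An `L^p` pair sum with a symmetric kernel and `L^p` diagonal has an `L^p` kernel. -/
theorem memLp_of_memLp_sum_sum [DecidableEq ι] [Nontrivial ι] (hp : 1 ≤ p) (hh : Measurable h)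
    (hsymm : ∀ x y, h (x, y) = h (y, x)) (hdiag : MemLp (fun x => h (x, x)) p μ)
    (hsum : MemLp (fun ω : ι → E => ∑ i, ∑ j, h (ω i, ω j)) p (Measure.pi fun _ => μ)) :
    MemLp h p (μ.prod μ) := by
  obtain ⟨i, j, hij⟩ := exists_pair_ne ι
  have hp0 : p ≠ 0 := by omega
  set P : Measure (ι → E) := Measure.pi fun _ => μ
  set T : Finset ι := (Finset.univ.erase i).erase j with hT
  have hTi : ∀ l ∈ T, l ≠ i := fun l hl => Finset.ne_of_mem_erase (Finset.mem_of_mem_erase hl)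
  have hTj : ∀ l ∈ T, l ≠ j := fun l hl => Finset.ne_of_mem_erase hl
  have hhpair : ∀ k l : ι, Measurable fun ω : ι → E => h (ω k, ω l) :=
    fun k l => hh.comp (by fun_prop)
  have hfst : ∀ {u : E → ℝ}, MemLp u p μ → MemLp (fun z : E × E => u z.1) p (μ.prod μ) :=
    fun hu => hu.comp_measurePreserving measurePreserving_fst
  have hsnd : ∀ {u : E → ℝ}, MemLp u p μ → MemLp (fun z : E × E => u z.2) p (μ.prod μ) :=
    fun hu => hu.comp_measurePreserving measurePreserving_snd
  obtain ⟨b, hb, hq⟩ : ∃ b : E → ℝ, Measurable b ∧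
      MemLp (fun z : E × E => h z + b z.1 + b z.2) p (μ.prod μ) := by
    have hpres : MeasurePreserving
        (fun q : (ι → E) × E × E => Function.update (Function.update q.1 i q.2.1) j q.2.2)
        (P.prod (μ.prod μ)) P :=
      ((measurePreserving_update_pi j).comp
        ((measurePreserving_update_pi i).prod (MeasurePreserving.id μ))).comp
        ((measurePreserving_prodAssoc P μ μ).symm MeasurableEquiv.prodAssoc)
    have hS : Measurable fun ω : ι → E => ∑ i, ∑ j, h (ω i, ω j) := by fun_prop
    obtain ⟨ω, hω⟩ := (hsum.comp_measurePreserving hpres).exists_section hp0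
      (hS.comp hpres.measurable)
    refine ⟨fun x => ∑ l ∈ T, h (x, ω l),
      Finset.measurable_fun_sum _ fun l _ => hh.comp (by fun_prop), ?_⟩
    have := (((hω.sub (hfst hdiag)).sub (hsnd hdiag)).sub
      (memLp_const (∑ k ∈ T, ∑ l ∈ T, h (ω k, ω l)))).const_mul (1 / 2)
    refine this.congr_norm (by fun_prop) (.of_forall ?_)
    rintro ⟨x, y⟩
    congr 1
    simp only [Pi.sub_apply, Function.comp_apply]
    rw [sum_sum_eq_of_symm (fun k l => hsymm _ _) hij]
    have hu : ∀ l ∈ T, Function.update (Function.update ω i x) j y l = ω l := fun l hl => by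
      rw [Function.update_of_ne (hTj l hl), Function.update_of_ne (hTi l hl)]
    have hi : Function.update (Function.update ω i x) j y i = x := by
      rw [Function.update_of_ne hij, Function.update_self]
    have hj : Function.update (Function.update ω i x) j y j = y := Function.update_self ..
    rw [hi, hj, ← hT]
    have hrow : ∀ z, ∑ l ∈ T, h (z, Function.update (Function.update ω i x) j y l)
        = ∑ l ∈ T, h (z, ω l) := fun z => Finset.sum_congr rfl fun l hl => by rw [hu l hl]
    have hblock : ∑ k ∈ T, ∑ l ∈ T, h (Function.update (Function.update ω i x) j y k, ω l)
        = ∑ k ∈ T, ∑ l ∈ T, h (ω k, ω l) := Finset.sum_congr rfl fun k hk => by rw [hu k hk]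
    simp_rw [hrow]
    rw [hblock]
    ring
  have hbL : MemLp b p μ := by
    have hcard : (Fintype.card ι : ℝ) - 1 ≠ 0 := by
      have := Fintype.one_lt_card (α := ι)
      exact sub_ne_zero.2 (by exact_mod_cast this.ne')
    have hqsum : MemLp (fun ω : ι → E => ∑ k, ∑ l ∈ Finset.univ.erase k,
        (h (ω k, ω l) + b (ω k) + b (ω l))) p P :=
      memLp_finsetSum _ fun k _ => memLp_finsetSum _ fun l hl =>
        hq.comp_measurePreserving (measurePreserving_pi_pair (Finset.ne_of_mem_erase hl).symm)
    have hdsum : MemLp (fun ω : ι → E => ∑ k, h (ω k, ω k)) p P :=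
      memLp_finsetSum _ fun k _ =>
        hdiag.comp_measurePreserving (measurePreserving_eval (fun _ => μ) k)
    have hB : Measurable fun ω : ι → E => ∑ k, b (ω k) :=
      Finset.measurable_fun_sum _ fun k _ => hb.comp (measurable_pi_apply k)
    have hbsum : MemLp (fun ω : ι → E => ∑ k, b (ω k)) p P := by
      refine (((hqsum.sub hsum).add hdsum).const_mul
        (1 / (2 * ((Fintype.card ι : ℝ) - 1)))).congr_norm hB.aestronglyMeasurable (.of_forall fun ω => ?_)
      congr 1
      simp only [Pi.sub_apply, Pi.add_apply, Finset.sum_erase_eq_sub (Finset.mem_univ _),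
        Finset.sum_sub_distrib, Finset.sum_add_distrib, Finset.sum_const, Finset.card_univ,
        nsmul_eq_mul, ← Finset.mul_sum]
      field_simp
      ring
    obtain ⟨ω, hω⟩ := (hbsum.comp_measurePreserving (measurePreserving_update_pi i)).exists_section
      hp0 (hB.comp (measurePreserving_update_pi i (μ := μ)).measurable)
    refine (hω.sub (memLp_const (∑ k ∈ Finset.univ.erase i, b (ω k)))).congr_norm
      hb.aestronglyMeasurable (.of_forall fun x => ?_)
    congr 1
    simp only [Pi.sub_apply, Function.comp_apply]
    rw [← Finset.add_sum_erase _ _ (Finset.mem_univ i), Function.update_self,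
      Finset.sum_congr rfl fun k hk => by rw [Function.update_of_ne (Finset.ne_of_mem_erase hk)]]
    ring
  refine ((hq.sub (hfst hbL)).sub (hsnd hbL)).congr_norm hh.aestronglyMeasurable
    (.of_forall fun z => ?_)
  congr 1
  simp only [Pi.sub_apply]
  ring

/-- Central moments of order `p ≥ 3` of a pair average with symmetric kernel are `O(n⁻²)`, with
the convention that the integral of a non-integrable function is zero. -/
theorem exists_bound_centralMoment (hp : 3 ≤ p) (hh : Measurable h)
    (hsymm : ∀ x y, h (x, y) = h (y, x)) (hdiag : MemLp (fun x => h (x, x)) p μ) :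
    ∃ C : ℝ, ∀ n : ℕ, 1 ≤ n →
      |∫ ω : Fin n → E, (1 / (n : ℝ) ^ 2 * ∑ i, ∑ j, h (ω i, ω j)
          - ∫ ω' : Fin n → E, 1 / (n : ℝ) ^ 2 * ∑ i, ∑ j, h (ω' i, ω' j)
              ∂Measure.pi fun _ => μ) ^ p ∂Measure.pi fun _ => μ| ≤ C / (n : ℝ) ^ 2 := by
  by_cases hoff : MemLp h p (μ.prod μ)
  · exact exists_bound_centralMoment_of_memLp hp hh hdiag hoff
  refine ⟨|∫ ω : Fin 1 → E, (1 / ((1 : ℕ) : ℝ) ^ 2 * ∑ i, ∑ j, h (ω i, ω j)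
          - ∫ ω' : Fin 1 → E, 1 / ((1 : ℕ) : ℝ) ^ 2 * ∑ i, ∑ j, h (ω' i, ω' j)
              ∂Measure.pi fun _ => μ) ^ p ∂Measure.pi fun _ => μ|, fun n hn => ?_⟩
  obtain rfl | hn2 : n = 1 ∨ 2 ≤ n := by omega
  · simp
  rw [integral_undef, abs_zero]
  · positivity
  intro hint
  refine hoff ?_
  have : Nontrivial (Fin n) := Fin.nontrivial_iff_two_le.2 hn2
  refine memLp_of_memLp_sum_sum (ι := Fin n) (by omega) hh hsymm hdiag ?_
  set c := ∫ ω' : Fin n → E, 1 / (n : ℝ) ^ 2 * ∑ i, ∑ j, h (ω' i, ω' j) ∂Measure.pi fun _ => μ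
  have hhpair : ∀ k l : Fin n, Measurable fun ω : Fin n → E => h (ω k, ω l) :=
    fun k l => hh.comp (by fun_prop)
  have hS : Measurable fun ω : Fin n → E => ∑ i, ∑ j, h (ω i, ω j) := by fun_prop
  have hA : MemLp (fun ω : Fin n → E => 1 / (n : ℝ) ^ 2 * ∑ i, ∑ j, h (ω i, ω j) - c) p
      (Measure.pi fun _ => μ) := by
    rw [← integrable_norm_rpow_iff ((hS.const_mul _).sub_const c).aestronglyMeasurable
      (by exact_mod_cast (by omega : p ≠ 0)) (by simp)]
    simpa [norm_pow] using hint.norm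
  refine ((hA.add (memLp_const c)).const_mul ((n : ℝ) ^ 2)).congr_norm
    hS.aestronglyMeasurable (.of_forall fun ω => ?_)
  congr 1
  simp only [Pi.add_apply]
  have : (n : ℝ) ≠ 0 := by exact_mod_cast (by omega : n ≠ 0)
  field_simp
  ring

end PairSum

/-- Third- and fourth-central-moment bounds of order `n⁻²` for the pair average
`A_n = (1/n²) Σ_{i,j} f(G_i, Ĝ_j)`, assuming `E[f(G,Ĝ)⁴] < ∞`. -/
theorem third_fourth_moment_bound (θ : ℝ) (hθ : θ ∈ Set.Icc 0 Real.pi)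
    (f : ℝ × ℝ → ℝ) (hf : Measurable f)
    (hf4 : Integrable (fun p : ℝ × ℝ => f (p.1, ghat θ p) ^ 4) pairLaw) :
    ∃ C : ℝ, ∀ n : ℕ, 1 ≤ n →
      |∫ ω, (Afun n θ f ω - ∫ ω', Afun n θ f ω' ∂piMeasure n) ^ 3 ∂piMeasure n|
          ≤ C / (n : ℝ) ^ 2 ∧
      (∫ ω, (Afun n θ f ω - ∫ ω', Afun n θ f ω' ∂piMeasure n) ^ 4 ∂piMeasure n)
          ≤ C / (n : ℝ) ^ 2 := by
  have : IsProbabilityMeasure _root_.stdGaussian := by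
    unfold _root_.stdGaussian; infer_instance
  have : IsProbabilityMeasure pairLaw := by unfold pairLaw; infer_instance
  have hghat : Measurable (ghat θ) := by unfold ghat; fun_prop
  have hdiagm : Measurable fun x : ℝ × ℝ => f (x.1, ghat θ x) := hf.comp (by fun_prop)
  let h : (ℝ × ℝ) × ℝ × ℝ → ℝ := fun z => (f (z.1.1, ghat θ z.2) + f (z.2.1, ghat θ z.1)) / 2
  have hh : Measurable h := by
    have h1 : Measurable fun z : (ℝ × ℝ) × ℝ × ℝ => f (z.1.1, ghat θ z.2) := hf.comp (by fun_prop)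
    have h2 : Measurable fun z : (ℝ × ℝ) × ℝ × ℝ => f (z.2.1, ghat θ z.1) := hf.comp (by fun_prop)
    exact (h1.add h2).div_const 2
  have hsymm : ∀ x y, h (x, y) = h (y, x) := fun x y => by simp only [h]; ring
  have hdiag_eq : (fun x => h (x, x)) = fun x => f (x.1, ghat θ x) := by
    funext x; simp only [h]; ring
  have hdiag4 : MemLp (fun x => h (x, x)) (4 : ℕ) pairLaw := by
    rw [hdiag_eq, ← integrable_norm_rpow_iff hdiagm.aestronglyMeasurable (by simp) (by simp)]
    simpa [norm_pow] using hf4.norm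
  have hdiag3 : MemLp (fun x => h (x, x)) (3 : ℕ) pairLaw :=
    hdiag4.mono_exponent (by exact_mod_cast (by norm_num : 3 ≤ 4))
  have hA : ∀ n (ω : Fin n → ℝ × ℝ),
      Afun n θ f ω = 1 / (n : ℝ) ^ 2 * ∑ i, ∑ j, h (ω i, ω j) := fun n ω => by
    simp only [Afun, h, ← Finset.sum_div, Finset.sum_add_distrib]
    rw [Finset.sum_comm (f := fun i j => f ((ω j).1, ghat θ (ω i)))]
    ring
  obtain ⟨C₃, hC₃⟩ := exists_bound_centralMoment le_rfl hh hsymm hdiag3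
  obtain ⟨C₄, hC₄⟩ := exists_bound_centralMoment (by norm_num) hh hsymm hdiag4
  refine ⟨max C₃ C₄, fun n hn => ?_⟩
  simp_rw [hA]
  exact ⟨(hC₃ n hn).trans (by gcongr; exact le_max_left _ _),
    (le_abs_self _).trans ((hC₄ n hn).trans (by gcongr; exact le_max_right _ _))⟩
end
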